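/- arXiv:1907.00288 — 8 statements merged into one kernel-verified Lean document; each statement's English description precedes it below -/
import Mathlib

section
/- Let λ be a σ-finite measure on a measurable space, and let P and Q be probability measures with densities p and q with respect to λ, both strictly positive on a common support ω. Let f: ω → ℝ be measurable with finite means E_P = E_P[f], E_Q = E_Q[f] and finite variances V_P = Var_P(f) > 0, V_Q = Var_Q(f) > 0. Set A = (E_Q − E_P)² + V_P + V_Q and D = √(A² − 4·V_P·V_Q). Then KL(P‖Q) ≥ ((A − 2·V_P)/D)·artanh(D/A) + (1/2)·log(V_P/V_Q). -/
open MeasureTheory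

/-- Inverse hyperbolic tangent. -/
noncomputable def artanh (x : ℝ) : ℝ := (1 / 2) * Real.log ((1 + x) / (1 - x))

open intervalIntegral in
/-- Taylor's formula with integral remainder for `u ↦ u log u`, in homogeneous form. -/
theorem integral_one_sub_mul_sq_div {p q : ℝ} (hp : 0 < p) (hq : 0 < q) :
    IntervalIntegrable (fun s => (1 - s) * ((p - q) ^ 2 / (q + s * (p - q)))) volume 0 1 ∧
      ∫ s in (0 : ℝ)..1, (1 - s) * ((p - q) ^ 2 / (q + s * (p - q))) =
        p * Real.log (p / q) - p + q := by
  have hr : ∀ s ∈ Set.uIcc (0 : ℝ) 1, 0 < q + s * (p - q) := by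
    intro s hs
    rw [Set.uIcc_of_le zero_le_one] at hs
    rcases hs.1.eq_or_lt with h | h
    · simpa [← h] using hq
    · nlinarith [mul_pos h hp, mul_nonneg (sub_nonneg.2 hs.2) hq.le]
  have hint : IntervalIntegrable
      (fun s => (1 - s) * ((p - q) ^ 2 / (q + s * (p - q)))) volume 0 1 := by
    apply ContinuousOn.intervalIntegrable
    exact (by fun_prop : ContinuousOn (fun s : ℝ => 1 - s) _).mul
      (ContinuousOn.div (by fun_prop) (by fun_prop) fun s hs => (hr s hs).ne')
  refine ⟨hint, ?_⟩
  rw [integral_eq_sub_of_hasDerivAt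
    (f := fun s => p * Real.log (q + s * (p - q)) - s * (p - q)) _ hint]
  · rw [Real.log_div hp.ne' hq.ne']
    simp only [one_mul, zero_mul, add_zero, add_sub_cancel, sub_zero]
    ring
  · intro s hs
    have hne := (hr s hs).ne'
    have hlin : HasDerivAt (fun s : ℝ => s * (p - q)) (p - q) s := by
      simpa using (hasDerivAt_id s).mul_const (p - q)
    refine ((((hlin.const_add q).log hne).const_mul p).sub hlin).congr_deriv ?_
    rw [mul_div_assoc', mul_div_assoc', div_sub' hne]
    congr 1
    ring

/-- A finite sum of products integrates to the same value in either order. -/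
theorem integral_intervalIntegral_sum_mul {α ι : Type*} [Fintype ι] [MeasurableSpace α]
    {μ : Measure α} {a b : ℝ} {φ : ι → ℝ → ℝ} {g : ι → α → ℝ}
    (hφ : ∀ i, IntervalIntegrable (φ i) volume a b) (hg : ∀ i, Integrable (g i) μ) :
    Integrable (fun x => ∫ s in a..b, ∑ i, φ i s * g i x) μ ∧
      ∫ x, (∫ s in a..b, ∑ i, φ i s * g i x) ∂μ = ∫ s in a..b, ∑ i, φ i s * ∫ x, g i x ∂μ := by
  have hsum : ∀ v : ι → ℝ, ∫ s in a..b, ∑ i, φ i s * v i = ∑ i, (∫ s in a..b, φ i s) * v i := by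
    intro v
    rw [intervalIntegral.integral_finsetSum fun i _ => (hφ i).mul_const _]
    simp only [intervalIntegral.integral_mul_const]
  simp only [hsum]
  refine ⟨integrable_finsetSum _ fun i _ => (hg i).const_mul _, ?_⟩
  rw [integral_finsetSum _ fun i _ => (hg i).const_mul _]
  simp only [integral_const_mul]

/-- The variance of a mixture of two distributions is positive. -/
theorem mixture_variance_pos {VP VQ δ s : ℝ} (hVP : 0 < VP) (hVQ : 0 < VQ)
    (hs : s ∈ Set.uIcc (0 : ℝ) 1) : 0 < (1 - s) * VQ + s * VP + s * (1 - s) * δ ^ 2 := by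
  rw [Set.uIcc_of_le zero_le_one] at hs
  have h1 := mul_nonneg (mul_nonneg hs.1 (sub_nonneg.2 hs.2)) (sq_nonneg δ)
  rcases hs.1.eq_or_lt with h | h
  · simpa [← h] using hVQ
  · nlinarith [mul_pos h hVP, mul_nonneg (sub_nonneg.2 hs.2) hVQ.le]

/-- The divergence is at least the integral, over the mixtures of the two distributions, of the
Hammersley–Chapman–Robbins lower bounds. -/
theorem integral_sq_div_mixture_variance_le_kl {α : Type*} [MeasurableSpace α] {μ : Measure α}
    {p q f : α → ℝ} (hp : ∀ᵐ x ∂μ, 0 < p x) (hq : ∀ᵐ x ∂μ, 0 < q x)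
    (hP : ∫ x, p x ∂μ = 1) (hQ : ∫ x, q x ∂μ = 1)
    (hPf : Integrable (fun x => p x * f x) μ) (hQf : Integrable (fun x => q x * f x) μ)
    (hPf2 : Integrable (fun x => p x * f x ^ 2) μ) (hQf2 : Integrable (fun x => q x * f x ^ 2) μ)
    (hKL : Integrable (fun x => p x * Real.log (p x / q x)) μ)
    {EP EQ VP VQ : ℝ} (hEP : EP = ∫ x, p x * f x ∂μ) (hEQ : EQ = ∫ x, q x * f x ∂μ)
    (hVP : VP = (∫ x, p x * f x ^ 2 ∂μ) - EP ^ 2) (hVQ : VQ = (∫ x, q x * f x ^ 2 ∂μ) - EQ ^ 2)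
    (hVPpos : 0 < VP) (hVQpos : 0 < VQ) :
    ∫ s in (0 : ℝ)..1, (1 - s) * ((EP - EQ) ^ 2 /
        ((1 - s) * VQ + s * VP + s * (1 - s) * (EP - EQ) ^ 2)) ≤
      ∫ x, p x * Real.log (p x / q x) ∂μ := by
  have hPi : Integrable p μ := .of_integral_ne_zero (by simp [hP])
  have hQi : Integrable q μ := .of_integral_ne_zero (by simp [hQ])
  set V : ℝ → ℝ := fun s => (1 - s) * VQ + s * VP + s * (1 - s) * (EP - EQ) ^ 2 with hV
  have hVpos : ∀ s ∈ Set.uIcc (0 : ℝ) 1, 0 < V s := fun s hs =>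
    mixture_variance_pos hVPpos hVQpos hs
  obtain ⟨c, hcdef⟩ : ∃ c : ℝ → ℝ, ∀ s, c s = (EP - EQ) / V s := ⟨_, fun _ => rfl⟩
  have hc : ContinuousOn c (Set.uIcc 0 1) := by
    rw [show c = fun s => (EP - EQ) / V s from funext hcdef]
    exact ContinuousOn.div (by fun_prop) (by fun_prop) fun s hs => (hVpos s hs).ne'
  obtain ⟨m, hmdef⟩ : ∃ m : ℝ → ℝ, ∀ s, m s = EQ + s * (EP - EQ) := ⟨_, fun _ => rfl⟩
  have hm : ContinuousOn m (Set.uIcc 0 1) := by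
    rw [show m = fun s => EQ + s * (EP - EQ) from funext hmdef]
    fun_prop
  let φ : Fin 6 → ℝ → ℝ := ![
    fun s => (1 - s) * (-2 * c s * m s - c s ^ 2 * m s ^ 2 * s),
    fun s => (1 - s) * (2 * c s + 2 * c s ^ 2 * m s * s),
    fun s => -(1 - s) * c s ^ 2 * s,
    fun s => (1 - s) * (2 * c s * m s - c s ^ 2 * m s ^ 2 * (1 - s)),
    fun s => (1 - s) * (-2 * c s + 2 * c s ^ 2 * m s * (1 - s)),
    fun s => -(1 - s) * c s ^ 2 * (1 - s)]
  let g : Fin 6 → α → ℝ := ![p, fun x => p x * f x, fun x => p x * f x ^ 2,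
    q, fun x => q x * f x, fun x => q x * f x ^ 2]
  have hφ : ∀ i, IntervalIntegrable (φ i) volume 0 1 := by
    intro i
    apply ContinuousOn.intervalIntegrable
    fin_cases i <;> dsimp [φ] <;> fun_prop
  have hg : ∀ i, Integrable (g i) μ := by
    intro i
    fin_cases i <;> simpa [g]
  have hpoint : ∀ s x, ∑ i, φ i s * g i x = (1 - s) * (2 * (p x - q x) * (c s * (f x - m s))
      - (c s * (f x - m s)) ^ 2 * (q x + s * (p x - q x))) := by
    intro s x
    simp [φ, g, Fin.sum_univ_succ]
    ring
  have hmean : ∀ s ∈ Set.uIcc (0 : ℝ) 1,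
      ∑ i, φ i s * ∫ x, g i x ∂μ = (1 - s) * ((EP - EQ) ^ 2 / V s) := by
    intro s hs
    have hP2 : ∫ x, p x * f x ^ 2 ∂μ = VP + EP ^ 2 := by rw [hVP]; ring
    have hQ2 : ∫ x, q x * f x ^ 2 ∂μ = VQ + EQ ^ 2 := by rw [hVQ]; ring
    have hexp : ∑ i, φ i s * ∫ x, g i x ∂μ =
        (1 - s) * (2 * c s * (EP - EQ) - c s ^ 2 * V s) := by
      simp [φ, g, Fin.sum_univ_succ, hP, hQ, ← hEP, ← hEQ, hP2, hQ2, hV, hmdef]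
      ring
    have := (hVpos s hs).ne'
    rw [hexp, hcdef]
    field_simp
    ring
  have hsub : Integrable (fun x => p x * Real.log (p x / q x) - p x) μ := hKL.sub hPi
  obtain ⟨hint, hswap⟩ := integral_intervalIntegral_sum_mul hφ hg
  have hle : ∫ x, (∫ s in (0 : ℝ)..1, ∑ i, φ i s * g i x) ∂μ ≤
      ∫ x, (p x * Real.log (p x / q x) - p x + q x) ∂μ := by
    apply integral_mono_ae hint (hsub.add hQi)
    filter_upwards [hp, hq] with x hpx hqx
    obtain ⟨hi, he⟩ := integral_one_sub_mul_sq_div hpx hqx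
    refine le_of_le_of_eq ?_ he
    have hlow : IntervalIntegrable (fun s => ∑ i, φ i s * g i x) volume 0 1 := by
      simpa only [Finset.sum_fn] using
        IntervalIntegrable.sum Finset.univ fun i _ => (hφ i).mul_const (g i x)
    refine intervalIntegral.integral_mono_on zero_le_one hlow hi fun s hs => ?_
    rw [hpoint]
    refine mul_le_mul_of_nonneg_left ?_ (sub_nonneg.2 hs.2)
    have hr : 0 < q x + s * (p x - q x) := by
      rcases hs.1.eq_or_lt with h | h
      · simpa [← h] using hqx
      · nlinarith [mul_pos h hpx, mul_nonneg (sub_nonneg.2 hs.2) hqx.le]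
    rw [le_div_iff₀ hr]
    nlinarith [sq_nonneg (p x - q x - c s * (f x - m s) * (q x + s * (p x - q x)))]
  rw [hswap, intervalIntegral.integral_congr hmean, integral_add hsub hQi,
    integral_sub hKL hPi, hP, hQ] at hle
  linarith

/-- Closed form of the integrated Hammersley–Chapman–Robbins bounds. -/
theorem integral_sq_div_mixture_variance {VP VQ δ A D : ℝ} (hVP : 0 < VP) (hVQ : 0 < VQ)
    (hA : A = δ ^ 2 + VP + VQ) (hD : 0 < D) (hD2 : D ^ 2 = A ^ 2 - 4 * VP * VQ) :
    ∫ s in (0 : ℝ)..1, (1 - s) * (δ ^ 2 / ((1 - s) * VQ + s * VP + s * (1 - s) * δ ^ 2)) =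
      (A - 2 * VP) / D * artanh (D / A) + (1 / 2) * Real.log (VP / VQ) := by
  have hApos : 0 < A := by rw [hA]; positivity
  have hDA : D < A := by
    apply lt_of_pow_lt_pow_left₀ 2 hApos.le
    nlinarith [mul_pos hVP hVQ]
  have hVpos : ∀ s ∈ Set.uIcc (0 : ℝ) 1, 0 < (1 - s) * VQ + s * VP + s * (1 - s) * δ ^ 2 :=
    fun s hs => mixture_variance_pos hVP hVQ hs
  have hlin : ∀ t, 0 < A + t → ∀ s ∈ Set.uIcc (0 : ℝ) 1,
      0 < 2 * VQ + (A - 2 * VQ + t) * s := by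
    intro t ht s hs
    rw [Set.uIcc_of_le zero_le_one] at hs
    rcases hs.1.eq_or_lt with h | h
    · simpa [← h] using hVQ
    · nlinarith [mul_pos h ht, mul_nonneg (sub_nonneg.2 hs.2) hVQ.le]
  have hplus := hlin D (by linarith)
  have hminus := hlin (-D) (by linarith)
  rw [intervalIntegral.integral_eq_sub_of_hasDerivAt (f := fun s =>
    (A - 2 * VP) / (2 * D) * (Real.log (2 * VQ + (A - 2 * VQ + D) * s)
      - Real.log (2 * VQ + (A - 2 * VQ + -D) * s))
    + (1 / 2) * Real.log ((1 - s) * VQ + s * VP + s * (1 - s) * δ ^ 2))]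
  · have hratio : (1 + D / A) / (1 - D / A) = (A + D) / (A - D) := by
      have : A - D ≠ 0 := by linarith
      have : 1 - D / A ≠ 0 := by
        rw [one_sub_div hApos.ne']
        positivity
      field_simp
    rw [artanh, hratio, Real.log_div (by linarith) (by linarith), Real.log_div hVP.ne' hVQ.ne']
    simp only [mul_one, mul_zero, add_zero, sub_self, sub_zero, zero_mul, one_mul, zero_add]
    rw [show 2 * VQ + (A - 2 * VQ + D) = A + D by ring,
      show 2 * VQ + (A - 2 * VQ + -D) = A - D by ring]
    field_simp
    ring
  · intro s hs
    have hV := hVpos s hs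
    have hp := hplus s hs
    have hm := hminus s hs
    have hlog : ∀ t, 0 < 2 * VQ + (A - 2 * VQ + t) * s →
        HasDerivAt (fun s => Real.log (2 * VQ + (A - 2 * VQ + t) * s))
          ((A - 2 * VQ + t) / (2 * VQ + (A - 2 * VQ + t) * s)) s := by
      intro t ht
      have h := ((hasDerivAt_id s).const_mul (A - 2 * VQ + t)).const_add (2 * VQ)
      simpa using h.log (by simpa using ht.ne')
    have hquad : HasDerivAt (fun s => (1 - s) * VQ + s * VP + s * (1 - s) * δ ^ 2)
        (VP - VQ + (1 - 2 * s) * δ ^ 2) s := by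
      have h1 := (hasDerivAt_id s).const_sub 1
      refine (((h1.mul_const VQ).add ((hasDerivAt_id s).mul_const VP)).add
        (((hasDerivAt_id s).mul h1).mul_const (δ ^ 2))).congr_deriv ?_
      simp only [id_eq]
      ring
    refine ((((hlog D hp).sub (hlog (-D) hm)).const_mul ((A - 2 * VP) / (2 * D))).add
      ((hquad.log hV.ne').const_mul (1 / 2))).congr_deriv ?_
    have hprod : (2 * VQ + (A - 2 * VQ + D) * s) * (2 * VQ + (A - 2 * VQ + -D) * s) =
        4 * VQ * ((1 - s) * VQ + s * VP + s * (1 - s) * δ ^ 2) := by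
      linear_combination (-s ^ 2) * hD2 + (4 * VQ * s - 4 * VQ * s ^ 2) * hA
    have hdiff : (A - 2 * VQ + D) / (2 * VQ + (A - 2 * VQ + D) * s)
        - (A - 2 * VQ + -D) / (2 * VQ + (A - 2 * VQ + -D) * s) =
        D / ((1 - s) * VQ + s * VP + s * (1 - s) * δ ^ 2) := by
      rw [div_sub_div _ _ hp.ne' hm.ne', hprod, div_eq_div_iff (by positivity) hV.ne']
      ring
    rw [hdiff, hA]
    field_simp
    ring
  · apply ContinuousOn.intervalIntegrable
    exact (by fun_prop : ContinuousOn (fun s : ℝ => 1 - s) _).mul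
      (ContinuousOn.div (by fun_prop) (by fun_prop) fun s hs => (hVpos s hs).ne')

/-- **New lower bound for the KL-divergence** (Theorem 1 of the paper, inequality part).
If `P, Q` are probability measures with densities `p, q` (w.r.t. a σ-finite measure `lam`),
both strictly positive on the common support `ω`, and `f` is a function of interest with
finite means `EP, EQ` and finite positive variances `VP, VQ`, then with
`A = (EQ - EP)^2 + VP + VQ` and `D = √(A^2 - 4 VP VQ)`,
`KL(P‖Q) ≥ ((A - 2 VP)/D) · artanh (D/A) + (1/2) · log (VP/VQ)`. -/
theorem kl_lower_bound
    {α : Type*} [MeasurableSpace α] (lam : Measure α) [SigmaFinite lam]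
    (ω : Set α) (hω : MeasurableSet ω)
    (p q f : α → ℝ)
    (hpm : Measurable p) (hqm : Measurable q) (hfm : Measurable f)
    (hppos : ∀ x ∈ ω, 0 < p x) (hqpos : ∀ x ∈ ω, 0 < q x)
    (hPnorm : ∫ x in ω, p x ∂lam = 1) (hQnorm : ∫ x in ω, q x ∂lam = 1)
    (hPf : IntegrableOn (fun x => p x * f x) ω lam)
    (hQf : IntegrableOn (fun x => q x * f x) ω lam)
    (hPf2 : IntegrableOn (fun x => p x * f x ^ 2) ω lam)
    (hQf2 : IntegrableOn (fun x => q x * f x ^ 2) ω lam)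
    (hKLint : IntegrableOn (fun x => p x * Real.log (p x / q x)) ω lam)
    (EP EQ VP VQ A D : ℝ)
    (hEP : EP = ∫ x in ω, p x * f x ∂lam)
    (hEQ : EQ = ∫ x in ω, q x * f x ∂lam)
    (hVP : VP = (∫ x in ω, p x * f x ^ 2 ∂lam) - EP ^ 2)
    (hVQ : VQ = (∫ x in ω, q x * f x ^ 2 ∂lam) - EQ ^ 2)
    (hVPpos : 0 < VP) (hVQpos : 0 < VQ)
    (hA : A = (EQ - EP) ^ 2 + VP + VQ)
    (hD : D = Real.sqrt (A ^ 2 - 4 * VP * VQ)) :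
    (∫ x in ω, p x * Real.log (p x / q x) ∂lam) ≥
      (A - 2 * VP) / D * artanh (D / A) + (1 / 2) * Real.log (VP / VQ) := by
  have hkl := integral_sq_div_mixture_variance_le_kl (ae_restrict_of_forall_mem hω hppos)
    (ae_restrict_of_forall_mem hω hqpos) hPnorm hQnorm hPf hQf hPf2 hQf2 hKLint
    hEP hEQ hVP hVQ hVPpos hVQpos
  have hdisc : A ^ 2 - 4 * VP * VQ =
      (VP - VQ) ^ 2 + (EP - EQ) ^ 2 * ((EP - EQ) ^ 2 + 2 * (VP + VQ)) := by
    rw [hA]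
    ring
  have hnonneg : 0 ≤ A ^ 2 - 4 * VP * VQ := by rw [hdisc]; positivity
  rcases (hD ▸ Real.sqrt_nonneg _ : 0 ≤ D).eq_or_lt with hD0 | hDpos
  · have hzero : A ^ 2 - 4 * VP * VQ = 0 := (Real.sqrt_eq_zero hnonneg).1 (hD ▸ hD0.symm)
    have hVeq : VP = VQ := by
      have : 0 ≤ (EP - EQ) ^ 2 * ((EP - EQ) ^ 2 + 2 * (VP + VQ)) := by positivity
      nlinarith [sq_nonneg (VP - VQ)]
    rw [← hD0, hVeq, div_self hVQpos.ne']
    simp only [div_zero, zero_mul, Real.log_one, mul_zero, add_zero]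
    refine le_trans (intervalIntegral.integral_nonneg zero_le_one fun s hs => ?_) hkl
    have := mixture_variance_pos (δ := EP - EQ) hVPpos hVQpos (Set.Icc_subset_uIcc hs)
    exact mul_nonneg (sub_nonneg.2 hs.2) (by positivity)
  · rwa [integral_sq_div_mixture_variance (A := A) hVPpos hVQpos (by rw [hA]; ring) hDpos
      (by rw [hD, Real.sq_sqrt hnonneg])] at hkl
end

section
/- Let λ be a σ-finite measure, P and Q probability measures with densities p, q strictly positive on a common support ω, and f: ω → ℝ measurable with finite means E_P, E_Q and finite variances V_P > 0, V_Q > 0. Set A = (E_Q − E_P)² + V_P + V_Q and D = √(A² − 4·V_P·V_Q). Then equality KL(P‖Q) = ((A − 2·V_P)/D)·artanh(D/A) + (1/2)·log(V_P/V_Q) holds if and only if there exists a function C: [0,1] → ℝ such that for all t ∈ [0,1] and λ-almost every x ∈ ω, (q(x) − p(x)) / (p(x) + t(q(x) − p(x))) = (f(x) − E_P − t(E_Q − E_P))·C(t). -/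
open MeasureTheory

lemma segment_pos {a b t : ℝ} (ha : 0 < a) (hb : 0 < b) (ht : t ∈ Set.Icc (0 : ℝ) 1) :
    0 < a + t * (b - a) := by
  obtain ⟨h0, h1⟩ := ht
  rcases h0.eq_or_lt with rfl | h
  · simpa using ha
  · nlinarith [mul_pos h hb, mul_nonneg (sub_nonneg.2 h1) ha.le]

lemma continuousOn_mul_sq_div {a b : ℝ} (ha : 0 < a) (hb : 0 < b) :
    ContinuousOn (fun t : ℝ => t * ((b - a) ^ 2 / (a + t * (b - a)))) (Set.Icc 0 1) := by
  refine ContinuousOn.mul (by fun_prop) (ContinuousOn.div (by fun_prop) (by fun_prop) ?_)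
  exact fun t ht => (segment_pos ha hb ht).ne'

lemma integral_mul_sq_div {a b : ℝ} (ha : 0 < a) (hb : 0 < b) :
    ∫ t in (0 : ℝ)..1, t * ((b - a) ^ 2 / (a + t * (b - a))) =
      a * Real.log (a / b) + (b - a) := by
  rw [intervalIntegral.integral_eq_sub_of_hasDerivAt
    (f := fun t => t * (b - a) - a * Real.log (a + t * (b - a)))]
  · rw [Real.log_div ha.ne' hb.ne']
    simp
    ring
  · intro t ht
    rw [Set.uIcc_of_le zero_le_one] at ht
    have hne := (segment_pos ha hb ht).ne'
    have h1 : HasDerivAt (fun t : ℝ => t * (b - a)) (b - a) t := by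
      simpa using (hasDerivAt_id t).mul_const (b - a)
    refine (h1.sub (((h1.const_add a).log hne).const_mul a)).congr_deriv ?_
    generalize hX : a + t * (b - a) = X at hne ⊢
    field_simp
    linear_combination -(b - a) * hX
  · exact (continuousOn_mul_sq_div ha hb).intervalIntegrable_of_Icc zero_le_one

/-- Variance of the mixture `(1 - t) P + t Q`, where `δ` is the difference of the means. -/
def mixVar (v w δ t : ℝ) : ℝ := v + t * (w - v + δ ^ 2) - t ^ 2 * δ ^ 2

lemma mixVar_pos {v w δ t : ℝ} (hv : 0 < v) (hw : 0 < w) (ht : t ∈ Set.Icc (0 : ℝ) 1) :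
    0 < mixVar v w δ t := by
  have h := segment_pos hv hw ht
  have h' : 0 ≤ t * (1 - t) * δ ^ 2 :=
    mul_nonneg (mul_nonneg ht.1 (sub_nonneg.2 ht.2)) (sq_nonneg δ)
  unfold mixVar
  linarith

lemma continuous_mixVar (v w δ : ℝ) : Continuous (mixVar v w δ) := by
  unfold mixVar
  fun_prop

lemma integral_mul_sq_div_mixVar {v w δ A D : ℝ} (hv : 0 < v) (hw : 0 < w)
    (hA : A = δ ^ 2 + v + w) (hD : D = √(A ^ 2 - 4 * v * w)) :
    ∫ t in (0 : ℝ)..1, t * (δ ^ 2 / mixVar v w δ t) =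
      (A - 2 * v) / D * artanh (D / A) + 1 / 2 * Real.log (v / w) := by
  have hA0 : 0 < A := by rw [hA]; positivity
  rcases eq_or_ne δ 0 with rfl | hδ
  · have hA' : A = v + w := by rw [hA]; ring
    have hD' : D = |w - v| := by
      rw [hD, ← Real.sqrt_sq_eq_abs, hA']
      ring_nf
    rcases lt_trichotomy v w with h | rfl | h
    · rw [abs_of_pos (sub_pos.2 h)] at hD'
      have h1 : (1 + D / A) / (1 - D / A) = w / v := by
        rw [hD', hA'] at *
        have : v + w - (w - v) ≠ 0 := by linarith
        field_simp
        ring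
      have h2 : (A - 2 * v) / D = 1 := by
        rw [hD', hA', div_eq_one_iff_eq (by linarith)]
        ring
      rw [artanh, h1, h2, Real.log_div hw.ne' hv.ne', Real.log_div hv.ne' hw.ne']
      simp
      ring
    · simp [hD', artanh, hv.ne']
    · rw [abs_of_neg (sub_neg.2 h)] at hD'
      have h1 : (1 + D / A) / (1 - D / A) = v / w := by
        rw [hD', hA'] at *
        have : v + w - -(w - v) ≠ 0 := by linarith
        field_simp
        ring
      have h2 : (A - 2 * v) / D = -1 := by
        rw [hD', hA', div_eq_iff (by linarith)]
        ring
      rw [artanh, h1, h2]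
      simp
  have hδ2 : 0 < δ ^ 2 := by positivity
  have hrad : 0 < A ^ 2 - 4 * v * w := by
    have : A ^ 2 - 4 * v * w = (δ ^ 2) ^ 2 + 2 * δ ^ 2 * (v + w) + (v - w) ^ 2 := by
      rw [hA]; ring
    rw [this]
    positivity
  have hD0 : 0 < D := by rw [hD]; exact Real.sqrt_pos.2 hrad
  have hDsq : D ^ 2 = A ^ 2 - 4 * v * w := by rw [hD]; exact Real.sq_sqrt hrad.le
  have hDA : D < A := by nlinarith [mul_pos hv hw]
  have key : ∀ t, D ^ 2 - (A - 2 * v - 2 * t * δ ^ 2) ^ 2 = 4 * δ ^ 2 * mixVar v w δ t := by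
    intro t
    rw [hDsq, mixVar, hA]
    ring
  have bounds : ∀ t ∈ Set.Icc (0 : ℝ) 1, 0 < D - (A - 2 * v - 2 * t * δ ^ 2) ∧
      0 < D + (A - 2 * v - 2 * t * δ ^ 2) := by
    intro t ht
    have h1 := mul_pos (mul_pos four_pos hδ2) (mixVar_pos (δ := δ) hv hw ht)
    rw [← key t] at h1
    have h2 := abs_lt_of_sq_lt_sq (sub_pos.1 h1) hD0.le
    rw [abs_lt] at h2
    constructor <;> linarith
  rw [intervalIntegral.integral_eq_sub_of_hasDerivAt
    (f := fun t => (A - 2 * v) / (2 * D) * (Real.log (D - (A - 2 * v - 2 * t * δ ^ 2)) -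
      Real.log (D + (A - 2 * v - 2 * t * δ ^ 2))) - 1 / 2 * Real.log (mixVar v w δ t))]
  · obtain ⟨a0, b0⟩ := bounds 0 (by simp)
    obtain ⟨a1, b1⟩ := bounds 1 (by simp)
    have e0 : mixVar v w δ 0 = v := by simp [mixVar]
    have e1 : mixVar v w δ 1 = w := by
      simp only [mixVar]
      ring
    have hlog : Real.log ((1 + D / A) / (1 - D / A)) =
        (Real.log (D - (A - 2 * v - 2 * 1 * δ ^ 2)) -
          Real.log (D + (A - 2 * v - 2 * 1 * δ ^ 2))) -
        (Real.log (D - (A - 2 * v - 2 * 0 * δ ^ 2)) -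
          Real.log (D + (A - 2 * v - 2 * 0 * δ ^ 2))) := by
      rw [← Real.log_div a1.ne' b1.ne', ← Real.log_div a0.ne' b0.ne',
        ← Real.log_div (div_pos a1 b1).ne' (div_pos a0 b0).ne', div_div_div_eq]
      congr 1
      have h3 : 0 < 1 - D / A := by rw [sub_pos, div_lt_one hA0]; exact hDA
      rw [div_eq_div_iff h3.ne' (mul_pos b1 a0).ne']
      have h4 : (D - (A - 2 * v - 2 * 1 * δ ^ 2)) * (D + (A - 2 * v - 2 * 0 * δ ^ 2)) =
          2 * δ ^ 2 * A * (1 + D / A) := by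
        field_simp
        have : w = A - δ ^ 2 - v := by rw [hA]; ring
        linear_combination hDsq - 4 * v * this
      have h5 : (D + (A - 2 * v - 2 * 1 * δ ^ 2)) * (D - (A - 2 * v - 2 * 0 * δ ^ 2)) =
          2 * δ ^ 2 * A * (1 - D / A) := by
        field_simp
        have : w = A - δ ^ 2 - v := by rw [hA]; ring
        linear_combination hDsq - 4 * v * this
      rw [h4, h5]
      ring
    simp only [e0, e1]
    rw [artanh, hlog, Real.log_div hv.ne' hw.ne']
    field_simp
    ring
  · intro t ht
    rw [Set.uIcc_of_le zero_le_one] at ht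
    obtain ⟨h1, h2⟩ := bounds t ht
    have hV := mixVar_pos (δ := δ) hv hw ht
    have d1 : HasDerivAt (fun t : ℝ => A - 2 * v - 2 * t * δ ^ 2) (-(2 * δ ^ 2)) t := by
      simpa using (((hasDerivAt_id t).const_mul 2).mul_const (δ ^ 2)).const_sub (A - 2 * v)
    have d2 : HasDerivAt (mixVar v w δ) (A - 2 * v - 2 * t * δ ^ 2) t := by
      have := (((hasDerivAt_id t).mul_const (w - v + δ ^ 2)).const_add v).sub
        (((hasDerivAt_id t).pow 2).mul_const (δ ^ 2))
      refine this.congr_deriv ?_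
      simp only [hA, id_eq]
      push_cast
      ring
    refine (((((d1.const_sub D).log h1.ne').sub ((d1.const_add D).log h2.ne')).const_mul
      ((A - 2 * v) / (2 * D))).sub ((d2.log hV.ne').const_mul (1 / 2))).congr_deriv ?_
    have h3 : - -(2 * δ ^ 2) / (D - (A - 2 * v - 2 * t * δ ^ 2)) -
        -(2 * δ ^ 2) / (D + (A - 2 * v - 2 * t * δ ^ 2)) = D / mixVar v w δ t := by
      rw [div_sub_div _ _ h1.ne' h2.ne', div_eq_div_iff (mul_pos h1 h2).ne' hV.ne']
      linear_combination -D * key t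
    rw [h3]
    field_simp
    ring
  · refine ContinuousOn.intervalIntegrable_of_Icc zero_le_one
      (continuousOn_id.mul (continuousOn_const.div (continuous_mixVar v w δ).continuousOn ?_))
    exact fun t ht => (mixVar_pos hv hw ht).ne'

section Mixture

variable {α : Type*} [MeasurableSpace α] {μ : Measure α} {p q f : α → ℝ} {EP EQ VP VQ : ℝ}

lemma integral_diff_mul_centered (hp : Integrable p μ) (hq : Integrable q μ)
    (hP : ∫ x, p x ∂μ = 1) (hQ : ∫ x, q x ∂μ = 1)
    (hPf : Integrable (fun x => p x * f x) μ) (hQf : Integrable (fun x => q x * f x) μ)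
    (hEP : EP = ∫ x, p x * f x ∂μ) (hEQ : EQ = ∫ x, q x * f x ∂μ) (t : ℝ) :
    Integrable (fun x => (q x - p x) * (f x - EP - t * (EQ - EP))) μ ∧
      ∫ x, (q x - p x) * (f x - EP - t * (EQ - EP)) ∂μ = EQ - EP := by
  have h : (fun x => (q x - p x) * (f x - EP - t * (EQ - EP))) = fun x =>
      (q x * f x - p x * f x) - (EP + t * (EQ - EP)) * (q x - p x) := by
    ext x
    ring
  rw [h]
  have i1 : Integrable (fun x => q x * f x - p x * f x) μ := hQf.sub hPf
  have i2 : Integrable (fun x => (EP + t * (EQ - EP)) * (q x - p x)) μ := (hq.sub hp).const_mul _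
  refine ⟨i1.sub i2, ?_⟩
  rw [integral_sub i1 i2, integral_sub hQf hPf,
    integral_const_mul, integral_sub hq hp, hP, hQ, ← hEP, ← hEQ]
  ring

lemma integral_mul_centered_sq {g : α → ℝ} {E V : ℝ} (hg : Integrable g μ)
    (hgf : Integrable (fun x => g x * f x) μ) (hgf2 : Integrable (fun x => g x * f x ^ 2) μ)
    (hG : ∫ x, g x ∂μ = 1) (hE : E = ∫ x, g x * f x ∂μ)
    (hV : V = (∫ x, g x * f x ^ 2 ∂μ) - E ^ 2) (c : ℝ) :
    Integrable (fun x => g x * (f x - c) ^ 2) μ ∧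
      ∫ x, g x * (f x - c) ^ 2 ∂μ = V + (E - c) ^ 2 := by
  have h : (fun x => g x * (f x - c) ^ 2) = fun x =>
      g x * f x ^ 2 - 2 * c * (g x * f x) + c ^ 2 * g x := by
    ext x
    ring
  rw [h]
  have i : Integrable (fun x => g x * f x ^ 2 - 2 * c * (g x * f x)) μ :=
    hgf2.sub (hgf.const_mul _)
  refine ⟨i.add (hg.const_mul _), ?_⟩
  rw [integral_add i (hg.const_mul _),
    integral_sub hgf2 (hgf.const_mul _), integral_const_mul, integral_const_mul, hG, ← hE, hV]
  ring

lemma integral_mix_mul_centered_sq (hp : Integrable p μ) (hq : Integrable q μ)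
    (hP : ∫ x, p x ∂μ = 1) (hQ : ∫ x, q x ∂μ = 1)
    (hPf : Integrable (fun x => p x * f x) μ) (hQf : Integrable (fun x => q x * f x) μ)
    (hPf2 : Integrable (fun x => p x * f x ^ 2) μ) (hQf2 : Integrable (fun x => q x * f x ^ 2) μ)
    (hEP : EP = ∫ x, p x * f x ∂μ) (hEQ : EQ = ∫ x, q x * f x ∂μ)
    (hVP : VP = (∫ x, p x * f x ^ 2 ∂μ) - EP ^ 2)
    (hVQ : VQ = (∫ x, q x * f x ^ 2 ∂μ) - EQ ^ 2) (t : ℝ) :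
    Integrable (fun x => (p x + t * (q x - p x)) * (f x - EP - t * (EQ - EP)) ^ 2) μ ∧
      ∫ x, (p x + t * (q x - p x)) * (f x - EP - t * (EQ - EP)) ^ 2 ∂μ =
        mixVar VP VQ (EQ - EP) t := by
  obtain ⟨ip, ep⟩ := integral_mul_centered_sq hp hPf hPf2 hP hEP hVP (EP + t * (EQ - EP))
  obtain ⟨iq, eq⟩ := integral_mul_centered_sq hq hQf hQf2 hQ hEQ hVQ (EP + t * (EQ - EP))
  have h : (fun x => (p x + t * (q x - p x)) * (f x - EP - t * (EQ - EP)) ^ 2) = fun x =>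
      (1 - t) * (p x * (f x - (EP + t * (EQ - EP))) ^ 2) +
        t * (q x * (f x - (EP + t * (EQ - EP))) ^ 2) := by
    ext x
    ring
  rw [h]
  refine ⟨(ip.const_mul _).add (iq.const_mul _), ?_⟩
  rw [integral_add (ip.const_mul _) (iq.const_mul _), integral_const_mul, integral_const_mul,
    ep, eq, mixVar]
  ring

/-- The cross and quadratic terms of the completed square, integrated over `t` and `x`. -/
lemma integral_integral_defect [SFinite μ] (hp : Integrable p μ) (hq : Integrable q μ)
    (hP : ∫ x, p x ∂μ = 1) (hQ : ∫ x, q x ∂μ = 1)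
    (hPf : Integrable (fun x => p x * f x) μ) (hQf : Integrable (fun x => q x * f x) μ)
    (hPf2 : Integrable (fun x => p x * f x ^ 2) μ) (hQf2 : Integrable (fun x => q x * f x ^ 2) μ)
    (hEP : EP = ∫ x, p x * f x ∂μ) (hEQ : EQ = ∫ x, q x * f x ∂μ)
    (hVP : VP = (∫ x, p x * f x ^ 2 ∂μ) - EP ^ 2)
    (hVQ : VQ = (∫ x, q x * f x ^ 2 ∂μ) - EQ ^ 2) {c : ℝ → ℝ}
    (hc : ContinuousOn c (Set.Icc 0 1)) :
    Integrable (fun x => ∫ t in (0 : ℝ)..1,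
      (t * c t ^ 2 * ((p x + t * (q x - p x)) * (f x - EP - t * (EQ - EP)) ^ 2) -
        2 * t * c t * ((q x - p x) * (f x - EP - t * (EQ - EP))))) μ ∧
    ∫ x, (∫ t in (0 : ℝ)..1,
      (t * c t ^ 2 * ((p x + t * (q x - p x)) * (f x - EP - t * (EQ - EP)) ^ 2) -
        2 * t * c t * ((q x - p x) * (f x - EP - t * (EQ - EP))))) ∂μ =
      ∫ t in (0 : ℝ)..1,
        (t * c t ^ 2 * mixVar VP VQ (EQ - EP) t - 2 * t * c t * (EQ - EP)) := by
  have hint : ∀ {a : ℝ → ℝ}, ContinuousOn a (Set.Icc 0 1) →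
      Integrable a (volume.restrict (Set.Ioc (0 : ℝ) 1)) := fun ha =>
    (ha.integrableOn_Icc).mono_set Set.Ioc_subset_Icc_self
  have hprod : Integrable (Function.uncurry fun (t : ℝ) (x : α) =>
      t * c t ^ 2 * ((p x + t * (q x - p x)) * (f x - EP - t * (EQ - EP)) ^ 2) -
        2 * t * c t * ((q x - p x) * (f x - EP - t * (EQ - EP))))
      ((volume.restrict (Set.Ioc (0 : ℝ) 1)).prod μ) := by
    have m1 := (hint (a := fun t => t * c t ^ 2 * (1 - t)) (by fun_prop)).mul_prod hPf2
    have m2 := (hint (a := fun t => 2 * t * c t - 2 * t * c t ^ 2 * (1 - t) *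
      (EP + t * (EQ - EP))) (by fun_prop)).mul_prod hPf
    have m3 := (hint (a := fun t => t * c t ^ 2 * (1 - t) * (EP + t * (EQ - EP)) ^ 2 -
      2 * t * c t * (EP + t * (EQ - EP))) (by fun_prop)).mul_prod hp
    have m4 := (hint (a := fun t => t ^ 2 * c t ^ 2) (by fun_prop)).mul_prod hQf2
    have m5 := (hint (a := fun t => -2 * t * c t - 2 * t ^ 2 * c t ^ 2 *
      (EP + t * (EQ - EP))) (by fun_prop)).mul_prod hQf
    have m6 := (hint (a := fun t => t ^ 2 * c t ^ 2 * (EP + t * (EQ - EP)) ^ 2 +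
      2 * t * c t * (EP + t * (EQ - EP))) (by fun_prop)).mul_prod hq
    refine (((((m1.add m2).add m3).add m4).add m5).add m6).congr (.of_forall ?_)
    rintro ⟨t, x⟩
    simp only [Pi.add_apply, Function.uncurry_apply_pair]
    ring
  simp only [intervalIntegral.integral_of_le zero_le_one]
  refine ⟨hprod.integral_prod_right, ?_⟩
  rw [← integral_integral_swap hprod]
  congr 1 with t
  obtain ⟨i1, e1⟩ := integral_mix_mul_centered_sq hp hq hP hQ hPf hQf hPf2 hQf2 hEP hEQ hVP hVQ t
  obtain ⟨i2, e2⟩ := integral_diff_mul_centered hp hq hP hQ hPf hQf hEP hEQ t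
  rw [integral_sub (i1.const_mul _) (i2.const_mul _), integral_const_mul, integral_const_mul,
    e1, e2]

/-- The defect in the Cauchy–Schwarz inequality at the mixture parameter `t`, with densities
`a`, `b`, multiplier `c` and centered value `y t`. -/
lemma integral_defect {a b : ℝ} (ha : 0 < a) (hb : 0 < b) {c y : ℝ → ℝ}
    (hc : ContinuousOn c (Set.Icc 0 1)) (hy : Continuous y) :
    IntervalIntegrable (fun t => t * (a + t * (b - a)) *
      ((b - a) / (a + t * (b - a)) - y t * c t) ^ 2) volume 0 1 ∧
    ∫ t in (0 : ℝ)..1, t * (a + t * (b - a)) *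
      ((b - a) / (a + t * (b - a)) - y t * c t) ^ 2 =
    (a * Real.log (a / b) + (b - a)) +
      ∫ t in (0 : ℝ)..1, (t * c t ^ 2 * ((a + t * (b - a)) * y t ^ 2) -
        2 * t * c t * ((b - a) * y t)) := by
  have i1 : IntervalIntegrable (fun t : ℝ => t * ((b - a) ^ 2 / (a + t * (b - a)))) volume 0 1 :=
    (continuousOn_mul_sq_div ha hb).intervalIntegrable_of_Icc zero_le_one
  have i2 : IntervalIntegrable (fun t : ℝ => t * c t ^ 2 * ((a + t * (b - a)) * y t ^ 2) -
      2 * t * c t * ((b - a) * y t)) volume 0 1 :=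
    ContinuousOn.intervalIntegrable_of_Icc zero_le_one (by fun_prop)
  have heq : Set.EqOn (fun t => t * ((b - a) ^ 2 / (a + t * (b - a))) +
      (t * c t ^ 2 * ((a + t * (b - a)) * y t ^ 2) - 2 * t * c t * ((b - a) * y t)))
      (fun t => t * (a + t * (b - a)) * ((b - a) / (a + t * (b - a)) - y t * c t) ^ 2)
      (Set.Icc 0 1) := by
    intro t ht
    have hne := (segment_pos ha hb ht).ne'
    dsimp only
    generalize a + t * (b - a) = X at hne
    field_simp
    ring
  rw [← integral_mul_sq_div ha hb, ← intervalIntegral.integral_add i1 i2]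
  refine ⟨(i1.add i2).congr ?_, intervalIntegral.integral_congr ?_⟩
  · rw [Set.uIoc_of_le zero_le_one]
    exact heq.mono Set.Ioc_subset_Icc_self
  · rw [Set.uIcc_of_le zero_le_one]
    exact heq.symm

lemma integral_defect_eq_zero_iff {a b : ℝ} (ha : 0 < a) (hb : 0 < b) {c y : ℝ → ℝ}
    (hc : ContinuousOn c (Set.Icc 0 1)) (hy : Continuous y) :
    ∫ t in (0 : ℝ)..1, t * (a + t * (b - a)) *
      ((b - a) / (a + t * (b - a)) - y t * c t) ^ 2 = 0 ↔
    ∀ᵐ t ∂volume.restrict (Set.Ioc (0 : ℝ) 1), (b - a) / (a + t * (b - a)) = y t * c t := by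
  rw [intervalIntegral.integral_eq_zero_iff_of_le_of_nonneg_ae zero_le_one ?_
    (integral_defect ha hb hc hy).1]
  · refine Filter.eventually_congr ?_
    filter_upwards [ae_restrict_mem measurableSet_Ioc] with t ht
    have h := segment_pos ha hb (Set.Ioc_subset_Icc_self ht)
    simp [ht.1.ne', h.ne', sub_eq_zero]
  · filter_upwards [ae_restrict_mem measurableSet_Ioc] with t ht
    have h := segment_pos ha hb (Set.Ioc_subset_Icc_self ht)
    have := ht.1
    simp only [Pi.zero_apply]
    positivity

lemma forall_mem_Icc_of_ae_mem_Ioc {a b : ℝ} (ha : 0 < a) (hb : 0 < b) {c y : ℝ → ℝ}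
    (hc : ContinuousOn c (Set.Icc 0 1)) (hy : Continuous y)
    (h : ∀ᵐ t ∂volume.restrict (Set.Ioc (0 : ℝ) 1), (b - a) / (a + t * (b - a)) = y t * c t) :
    ∀ t ∈ Set.Icc (0 : ℝ) 1, (b - a) / (a + t * (b - a)) = y t * c t := by
  rw [restrict_Ioc_eq_restrict_Icc] at h
  exact Measure.eqOn_Icc_of_ae_eq volume zero_ne_one h
    (ContinuousOn.div (by fun_prop) (by fun_prop) fun t ht => (segment_pos ha hb ht).ne')
    (by fun_prop)

end Mixture

/-- **Equality condition of the new lower bound for the KL-divergence**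
(Theorem 1 of the paper, equality part).  Under the hypotheses of the lower bound,
equality `KL(P‖Q) = ((A - 2 VP)/D) · artanh (D/A) + (1/2) · log (VP/VQ)` holds
if and only if there exists a function `C : [0,1] → ℝ` such that for all `t ∈ [0,1]`
and λ-almost every `x ∈ ω`,
`(q x - p x) / (p x + t (q x - p x)) = (f x - EP - t (EQ - EP)) · C t`. -/
theorem kl_lower_bound_equality_iff
    {α : Type*} [MeasurableSpace α] (lam : Measure α) [SigmaFinite lam]
    (ω : Set α) (hω : MeasurableSet ω)
    (p q f : α → ℝ)
    (hpm : Measurable p) (hqm : Measurable q) (hfm : Measurable f)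
    (hppos : ∀ x ∈ ω, 0 < p x) (hqpos : ∀ x ∈ ω, 0 < q x)
    (hPnorm : ∫ x in ω, p x ∂lam = 1) (hQnorm : ∫ x in ω, q x ∂lam = 1)
    (hPf : IntegrableOn (fun x => p x * f x) ω lam)
    (hQf : IntegrableOn (fun x => q x * f x) ω lam)
    (hPf2 : IntegrableOn (fun x => p x * f x ^ 2) ω lam)
    (hQf2 : IntegrableOn (fun x => q x * f x ^ 2) ω lam)
    (hKLint : IntegrableOn (fun x => p x * Real.log (p x / q x)) ω lam)
    (EP EQ VP VQ A D : ℝ)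
    (hEP : EP = ∫ x in ω, p x * f x ∂lam)
    (hEQ : EQ = ∫ x in ω, q x * f x ∂lam)
    (hVP : VP = (∫ x in ω, p x * f x ^ 2 ∂lam) - EP ^ 2)
    (hVQ : VQ = (∫ x in ω, q x * f x ^ 2 ∂lam) - EQ ^ 2)
    (hVPpos : 0 < VP) (hVQpos : 0 < VQ)
    (hA : A = (EQ - EP) ^ 2 + VP + VQ)
    (hD : D = Real.sqrt (A ^ 2 - 4 * VP * VQ)) :
    (∫ x in ω, p x * Real.log (p x / q x) ∂lam) =
      (A - 2 * VP) / D * artanh (D / A) + (1 / 2) * Real.log (VP / VQ) ↔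
    ∃ C : ℝ → ℝ, ∀ t ∈ Set.Icc (0 : ℝ) 1,
      ∀ᵐ x ∂(lam.restrict ω),
        (q x - p x) / (p x + t * (q x - p x)) = (f x - EP - t * (EQ - EP)) * C t := by
  have hp : IntegrableOn p ω lam := by
    by_contra h
    exact one_ne_zero (hPnorm.symm.trans (integral_undef h))
  have hq : IntegrableOn q ω lam := by
    by_contra h
    exact one_ne_zero (hQnorm.symm.trans (integral_undef h))
  set c : ℝ → ℝ := fun t => (EQ - EP) / mixVar VP VQ (EQ - EP) t with hcdef
  have hc : ContinuousOn c (Set.Icc 0 1) :=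
    continuousOn_const.div (continuous_mixVar _ _ _).continuousOn
      fun t ht => (mixVar_pos hVPpos hVQpos ht).ne'
  have hcm : Measurable c := measurable_const.div (continuous_mixVar _ _ _).measurable
  have hy : ∀ x, Continuous fun t : ℝ => f x - EP - t * (EQ - EP) := fun x => by fun_prop
  obtain ⟨hRint, hR⟩ := integral_integral_defect hp hq hPnorm hQnorm hPf hQf hPf2 hQf2
    hEP hEQ hVP hVQ hc
  have hRbound : ∫ t in (0 : ℝ)..1,
      (t * c t ^ 2 * mixVar VP VQ (EQ - EP) t - 2 * t * c t * (EQ - EP)) =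
      -((A - 2 * VP) / D * artanh (D / A) + (1 / 2) * Real.log (VP / VQ)) := by
    rw [← integral_mul_sq_div_mixVar hVPpos hVQpos hA hD, ← intervalIntegral.integral_neg]
    refine intervalIntegral.integral_congr fun t ht => ?_
    rw [Set.uIcc_of_le zero_le_one] at ht
    have hV := (mixVar_pos (δ := EQ - EP) hVPpos hVQpos ht).ne'
    simp only [hcdef]
    field_simp
    ring
  have hdefect : (fun x => ∫ t in (0 : ℝ)..1, t * (p x + t * (q x - p x)) *
      ((q x - p x) / (p x + t * (q x - p x)) - (f x - EP - t * (EQ - EP)) * c t) ^ 2)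
      =ᵐ[lam.restrict ω] fun x => (p x * Real.log (p x / q x) + (q x - p x)) +
        ∫ t in (0 : ℝ)..1,
          (t * c t ^ 2 * ((p x + t * (q x - p x)) * (f x - EP - t * (EQ - EP)) ^ 2) -
            2 * t * c t * ((q x - p x) * (f x - EP - t * (EQ - EP)))) := by
    filter_upwards [ae_restrict_mem hω] with x hx
    exact (integral_defect (hppos x hx) (hqpos x hx) hc (hy x)).2
  have hqp : Integrable (fun x => q x - p x) (lam.restrict ω) := Integrable.sub hq hp
  have hKL' : Integrable (fun x => p x * Real.log (p x / q x) + (q x - p x)) (lam.restrict ω) :=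
    Integrable.add hKLint hqp
  have htotal := (integral_congr_ae hdefect).trans (integral_add hKL' hRint)
  rw [integral_add hKLint hqp, integral_sub hq hp, hPnorm, hQnorm, hR,
    hRbound] at htotal
  have hnonneg : 0 ≤ᵐ[lam.restrict ω] fun x => ∫ t in (0 : ℝ)..1, t * (p x + t * (q x - p x)) *
      ((q x - p x) / (p x + t * (q x - p x)) - (f x - EP - t * (EQ - EP)) * c t) ^ 2 := by
    filter_upwards [ae_restrict_mem hω] with x hx
    refine intervalIntegral.integral_nonneg zero_le_one fun t ht => ?_
    have := segment_pos (hppos x hx) (hqpos x hx) ht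
    have := ht.1
    positivity
  have hzero := integral_eq_zero_iff_of_nonneg_ae hnonneg ((hKL'.add hRint).congr hdefect.symm)
  rw [htotal, sub_self, add_zero, ← sub_eq_add_neg, sub_eq_zero] at hzero
  have hiff : (∫ x in ω, p x * Real.log (p x / q x) ∂lam) =
      (A - 2 * VP) / D * artanh (D / A) + (1 / 2) * Real.log (VP / VQ) ↔
      ∀ᵐ x ∂(lam.restrict ω), ∀ᵐ t ∂volume.restrict (Set.Ioc (0 : ℝ) 1),
        (q x - p x) / (p x + t * (q x - p x)) = (f x - EP - t * (EQ - EP)) * c t := by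
    rw [hzero]
    refine Filter.eventually_congr ?_
    filter_upwards [ae_restrict_mem hω] with x hx
    exact integral_defect_eq_zero_iff (hppos x hx) (hqpos x hx) hc (hy x)
  rw [hiff]
  constructor
  · intro h
    have h' : ∀ᵐ x ∂(lam.restrict ω), ∀ t ∈ Set.Icc (0 : ℝ) 1,
        (q x - p x) / (p x + t * (q x - p x)) = (f x - EP - t * (EQ - EP)) * c t := by
      filter_upwards [h, ae_restrict_mem hω] with x h hx
      exact forall_mem_Icc_of_ae_mem_Ioc (hppos x hx) (hqpos x hx) hc (hy x) h
    exact ⟨c, fun t ht => h'.mono fun x hx => hx t ht⟩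
  · rintro ⟨C, hC⟩
    have hmeas : MeasurableSet {z : ℝ × α | (q z.2 - p z.2) / (p z.2 + z.1 * (q z.2 - p z.2)) =
        (f z.2 - EP - z.1 * (EQ - EP)) * c z.1} :=
      measurableSet_eq_fun (by fun_prop) (by fun_prop)
    refine (Measure.ae_ae_comm hmeas).1 ?_
    filter_upwards [ae_restrict_mem measurableSet_Ioc] with t ht
    have ht' := Set.Ioc_subset_Icc_self ht
    have hCc : C t = c t := by
      have e1 := (integral_diff_mul_centered hp hq hPnorm hQnorm hPf hQf hEP hEQ t).2
      have e2 := (integral_mix_mul_centered_sq hp hq hPnorm hQnorm hPf hQf hPf2 hQf2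
        hEP hEQ hVP hVQ t).2
      rw [hcdef, eq_div_iff (mixVar_pos hVPpos hVQpos ht').ne', ← e2, ← integral_const_mul]
      refine Eq.trans (integral_congr_ae ?_) e1
      filter_upwards [hC t ht', ae_restrict_mem hω] with x hx hxω
      rw [div_eq_iff (segment_pos (hppos x hxω) (hqpos x hxω) ht').ne'] at hx
      linear_combination (-(f x - EP - t * (EQ - EP))) * hx
    simpa only [hCc] using hC t ht'
end

section
/- Let λ be a σ-finite measure, P and Q probability measures with densities p, q strictly positive on a common support ω, and f: ω → ℝ measurable with finite means E_P, E_Q and finite variances V_P > 0, V_Q > 0. Then KL(P‖Q) ≥ ∫₀¹ [ t·(E_Q − E_P)² / ( t(1−t)(E_Q − E_P)² + (1−t)·V_P + t·V_Q ) ] dt, where the integral is over t ∈ [0,1]. -/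
open MeasureTheory

/-- The derivative of the Kullback–Leibler integrand along the segment from `p` to `q`,
integrated back. -/
lemma integral_mul_sq_sub_div_segment {p q : ℝ} (hp : 0 < p) (hq : 0 < q) :
    IntervalIntegrable (fun t : ℝ => t * (q - p) ^ 2 / (p + t * (q - p))) volume 0 1 ∧
    ∫ t in (0 : ℝ)..1, t * (q - p) ^ 2 / (p + t * (q - p)) = p * Real.log (p / q) + (q - p) := by
  have hpos : ∀ t ∈ Set.uIcc (0 : ℝ) 1, 0 < p + t * (q - p) := by
    intro t ht
    rw [Set.uIcc_of_le zero_le_one] at ht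
    rcases ht with ⟨h0, h1⟩
    by_cases h : t = 1
    · subst h; linarith
    · have : 0 < (1 - t) * p := mul_pos (sub_pos.2 (lt_of_le_of_ne h1 h)) hp
      nlinarith [mul_nonneg h0 hq.le]
  have hint : IntervalIntegrable (fun t : ℝ => t * (q - p) ^ 2 / (p + t * (q - p))) volume 0 1 := by
    apply ContinuousOn.intervalIntegrable
    exact ContinuousOn.div (by fun_prop) (by fun_prop) fun t ht => (hpos t ht).ne'
  refine ⟨hint, ?_⟩
  have hderiv : ∀ t ∈ Set.uIcc (0 : ℝ) 1,
      HasDerivAt (fun t : ℝ => t * (q - p) - p * Real.log (p + t * (q - p)))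
        (t * (q - p) ^ 2 / (p + t * (q - p))) t := by
    intro t ht
    have hne := (hpos t ht).ne'
    have h1 : HasDerivAt (fun t : ℝ => t * (q - p)) (q - p) t := by
      simpa using (hasDerivAt_id t).mul_const (q - p)
    have h2 := h1.fun_sub (((h1.const_add p).log hne).const_mul p)
    refine h2.congr_deriv ?_
    rw [eq_div_iff hne, sub_mul, mul_assoc, div_mul_cancel₀ _ hne]
    ring
  rw [intervalIntegral.integral_eq_sub_of_hasDerivAt hderiv hint, Real.log_div hp.ne' hq.ne']
  simp
  ring

/-- Dual lower bound for the `χ²` integrand. -/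
lemma two_mul_sub_sq_mul_le_sq_div {d r : ℝ} (hr : 0 < r) (u : ℝ) :
    2 * u * d - u ^ 2 * r ≤ d ^ 2 / r := by
  rw [le_div_iff₀ hr]
  nlinarith [sq_nonneg (u * r - d)]

/-- Kullback–Leibler divergence dominates the integrated dual lower bound, for any continuous
choice of slope `c` and centre `m`. -/
lemma integral_quadratic_le_kl
    {α : Type*} [MeasurableSpace α] (μ : Measure α) [SigmaFinite μ]
    {p q f : α → ℝ} {c m : ℝ → ℝ}
    (hppos : ∀ᵐ x ∂μ, 0 < p x) (hqpos : ∀ᵐ x ∂μ, 0 < q x)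
    (hp : Integrable p μ) (hq : Integrable q μ)
    (hpq : ∫ x, p x ∂μ = ∫ x, q x ∂μ)
    (hPf : Integrable (fun x => p x * f x) μ)
    (hQf : Integrable (fun x => q x * f x) μ)
    (hPf2 : Integrable (fun x => p x * f x ^ 2) μ)
    (hQf2 : Integrable (fun x => q x * f x ^ 2) μ)
    (hKL : Integrable (fun x => p x * Real.log (p x / q x)) μ)
    (hc : ContinuousOn c (Set.Icc 0 1)) (hm : ContinuousOn m (Set.Icc 0 1)) :
    ∫ t in (0 : ℝ)..1, ∫ x, t * (2 * (c t * (f x - m t)) * (q x - p x)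
        - (c t * (f x - m t)) ^ 2 * (p x + t * (q x - p x))) ∂μ
      ≤ ∫ x, p x * Real.log (p x / q x) ∂μ := by
  set G : ℝ → α → ℝ := fun t x => t * (2 * (c t * (f x - m t)) * (q x - p x)
        - (c t * (f x - m t)) ^ 2 * (p x + t * (q x - p x))) with hG
  set ν : Measure ℝ := volume.restrict (Set.Ioc 0 1)
  have hcoef : ∀ a : ℝ → ℝ, ContinuousOn a (Set.Icc 0 1) → Integrable a ν := fun a ha =>
    (ha.integrableOn_compact isCompact_Icc).mono_set Set.Ioc_subset_Icc_self
  have hGint : Integrable (Function.uncurry G) (ν.prod μ) := by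
    have h1 := (hcoef (fun t => t * (-2 * c t * m t - c t ^ 2 * m t ^ 2 * t))
      (by fun_prop)).mul_prod hq
    have h2 := (hcoef (fun t => t * (2 * c t * m t - c t ^ 2 * m t ^ 2 * (1 - t)))
      (by fun_prop)).mul_prod hp
    have h3 := (hcoef (fun t => t * (2 * c t + 2 * c t ^ 2 * m t * t))
      (by fun_prop)).mul_prod hQf
    have h4 := (hcoef (fun t => t * (-2 * c t + 2 * c t ^ 2 * m t * (1 - t)))
      (by fun_prop)).mul_prod hPf
    have h5 := (hcoef (fun t => -t * c t ^ 2 * t) (by fun_prop)).mul_prod hQf2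
    have h6 := (hcoef (fun t => -t * c t ^ 2 * (1 - t)) (by fun_prop)).mul_prod hPf2
    refine (((((h1.add h2).add h3).add h4).add h5).add h6).congr (.of_forall ?_)
    rintro ⟨t, x⟩
    simp only [Pi.add_apply, Function.uncurry, hG]
    ring
  have hswap : ∫ t in (0 : ℝ)..1, ∫ x, G t x ∂μ = ∫ x, ∫ t, G t x ∂ν ∂μ := by
    rw [intervalIntegral.integral_of_le zero_le_one]
    exact integral_integral_swap hGint
  have hKL' : ∫ x, p x * Real.log (p x / q x) ∂μ
      = ∫ x, (p x * Real.log (p x / q x) + (q x - p x)) ∂μ := by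
    have hqp : Integrable (fun x => q x - p x) μ := hq.sub hp
    rw [integral_add hKL hqp, integral_sub hq hp, hpq]
    simp
  rw [hswap, hKL']
  refine integral_mono_ae hGint.integral_prod_right (hKL.add (hq.sub hp)) ?_
  filter_upwards [hppos, hqpos, hGint.prod_left_ae] with x hpx hqx hGx
  obtain ⟨hint, heq⟩ := integral_mul_sq_sub_div_segment hpx hqx
  simp only [← heq]
  rw [intervalIntegral.integral_of_le zero_le_one]
  refine setIntegral_mono_on hGx
    ((intervalIntegrable_iff_integrableOn_Ioc_of_le zero_le_one).1 hint) measurableSet_Ioc ?_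
  rintro t ⟨ht0, ht1⟩
  have hr : 0 < p x + t * (q x - p x) := by
    nlinarith [mul_pos ht0 hqx, mul_nonneg (sub_nonneg.2 ht1) hpx.le]
  simp only [hG, mul_div_assoc]
  exact mul_le_mul_of_nonneg_left (two_mul_sub_sq_mul_le_sq_div hr _) ht0.le

/-- **Integral form of the lower bound for the KL-divergence** (inequality (14) of the paper).
`KL(P‖Q) ≥ ∫₀¹ t (EQ-EP)² / ( t(1-t)(EQ-EP)² + (1-t) VP + t VQ ) dt`. -/
theorem kl_ge_integral_lower_bound
    {α : Type*} [MeasurableSpace α] (lam : Measure α) [SigmaFinite lam]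
    (ω : Set α) (hω : MeasurableSet ω)
    (p q f : α → ℝ)
    (hpm : Measurable p) (hqm : Measurable q) (hfm : Measurable f)
    (hppos : ∀ x ∈ ω, 0 < p x) (hqpos : ∀ x ∈ ω, 0 < q x)
    (hPnorm : ∫ x in ω, p x ∂lam = 1) (hQnorm : ∫ x in ω, q x ∂lam = 1)
    (hPf : IntegrableOn (fun x => p x * f x) ω lam)
    (hQf : IntegrableOn (fun x => q x * f x) ω lam)
    (hPf2 : IntegrableOn (fun x => p x * f x ^ 2) ω lam)
    (hQf2 : IntegrableOn (fun x => q x * f x ^ 2) ω lam)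
    (hKLint : IntegrableOn (fun x => p x * Real.log (p x / q x)) ω lam)
    (EP EQ VP VQ : ℝ)
    (hEP : EP = ∫ x in ω, p x * f x ∂lam)
    (hEQ : EQ = ∫ x in ω, q x * f x ∂lam)
    (hVP : VP = (∫ x in ω, p x * f x ^ 2 ∂lam) - EP ^ 2)
    (hVQ : VQ = (∫ x in ω, q x * f x ^ 2 ∂lam) - EQ ^ 2)
    (hVPpos : 0 < VP) (hVQpos : 0 < VQ) :
    (∫ x in ω, p x * Real.log (p x / q x) ∂lam) ≥
      ∫ t in (0 : ℝ)..1,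
        t * (EQ - EP) ^ 2 /
          (t * (1 - t) * (EQ - EP) ^ 2 + (1 - t) * VP + t * VQ) := by
  have hp : Integrable p (lam.restrict ω) := by
    by_contra h
    rw [integral_undef h] at hPnorm
    norm_num at hPnorm
  have hq : Integrable q (lam.restrict ω) := by
    by_contra h
    rw [integral_undef h] at hQnorm
    norm_num at hQnorm
  set V : ℝ → ℝ := fun t => t * (1 - t) * (EQ - EP) ^ 2 + (1 - t) * VP + t * VQ with hV
  set m : ℝ → ℝ := fun t => (1 - t) * EP + t * EQ with hm
  have hVpos : ∀ t ∈ Set.Icc (0 : ℝ) 1, 0 < V t := by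
    rintro t ⟨h0, h1⟩
    have h2 : 0 ≤ t * (1 - t) * (EQ - EP) ^ 2 :=
      mul_nonneg (mul_nonneg h0 (sub_nonneg.2 h1)) (sq_nonneg _)
    have h3 : 0 < (1 - t) * VP + t * VQ := by
      rcases eq_or_lt_of_le h0 with rfl | h0'
      · simpa using hVPpos
      · have := mul_nonneg (sub_nonneg.2 h1) hVPpos.le
        have := mul_pos h0' hVQpos
        linarith
    simp only [hV]
    linarith
  have hbound := integral_quadratic_le_kl (lam.restrict ω) (c := fun t => (EQ - EP) / V t) (m := m)
    (ae_restrict_of_forall_mem hω hppos) (ae_restrict_of_forall_mem hω hqpos) hp hq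
    (hPnorm.trans hQnorm.symm) hPf hQf hPf2 hQf2 hKLint
    (ContinuousOn.div (by fun_prop) (by fun_prop) fun t ht => (hVpos t ht).ne') (by fun_prop)
  refine ge_iff_le.2 (le_of_eq_of_le ?_ hbound)
  refine intervalIntegral.integral_congr fun t ht => ?_
  rw [Set.uIcc_of_le zero_le_one] at ht
  have hVt := (hVpos t ht).ne'
  set c := (EQ - EP) / V t with hc
  have hexp : ∀ x, t * (2 * (c * (f x - m t)) * (q x - p x)
        - (c * (f x - m t)) ^ 2 * (p x + t * (q x - p x)))
      = t * (-2 * c * m t - c ^ 2 * m t ^ 2 * t) * q x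
        + t * (2 * c * m t - c ^ 2 * m t ^ 2 * (1 - t)) * p x
        + t * (2 * c + 2 * c ^ 2 * m t * t) * (q x * f x)
        + t * (-2 * c + 2 * c ^ 2 * m t * (1 - t)) * (p x * f x)
        + -t * c ^ 2 * t * (q x * f x ^ 2)
        + -t * c ^ 2 * (1 - t) * (p x * f x ^ 2) := fun x => by ring
  have h1 := hq.const_mul (t * (-2 * c * m t - c ^ 2 * m t ^ 2 * t))
  have h2 := h1.fun_add (hp.const_mul (t * (2 * c * m t - c ^ 2 * m t ^ 2 * (1 - t))))
  have h3 := h2.fun_add (hQf.const_mul (t * (2 * c + 2 * c ^ 2 * m t * t)))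
  have h4 := h3.fun_add (hPf.const_mul (t * (-2 * c + 2 * c ^ 2 * m t * (1 - t))))
  have h5 := h4.fun_add (hQf2.const_mul (-t * c ^ 2 * t))
  have hP2 : ∫ x in ω, p x * f x ^ 2 ∂lam = VP + EP ^ 2 := by linarith
  have hQ2 : ∫ x in ω, q x * f x ^ 2 ∂lam = VQ + EQ ^ 2 := by linarith
  simp only [hexp]
  rw [integral_add h5 (hPf2.const_mul _), integral_add h4 (hQf2.const_mul _),
    integral_add h3 (hPf.const_mul _), integral_add h2 (hQf.const_mul _),
    integral_add h1 (hp.const_mul _)]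
  simp only [integral_const_mul]
  rw [hPnorm, hQnorm, ← hEP, ← hEQ, hP2, hQ2]
  have hcV : c * V t = EQ - EP := div_mul_cancel₀ _ hVt
  have hquot : t * (EQ - EP) ^ 2 / V t = t * (2 * c * (EQ - EP) - c * (c * V t)) := by
    rw [hcV, hc]
    ring
  refine hquot.trans ?_
  simp only [hV, hm]
  ring
end

section
/- Let λ be a σ-finite measure, P and Q probability measures with densities p, q strictly positive on a common support ω, and f: ω → ℝ measurable with finite means E_P, E_Q and finite variances V_P, V_Q, with V_Q > 0. Then χ²(P‖Q) ≥ (E_Q − E_P)² / V_Q. -/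
open MeasureTheory

theorem ofReal_integral_le_lintegral_ofReal {α : Type*} [MeasurableSpace α] {μ : Measure α}
    {h : α → ℝ} (hh : Integrable h μ) :
    ENNReal.ofReal (∫ x, h x ∂μ) ≤ ∫⁻ x, ENNReal.ofReal (h x) ∂μ := by
  rw [integral_eq_lintegral_pos_part_sub_lintegral_neg_part hh]
  refine (ENNReal.ofReal_le_ofReal (sub_le_self _ ENNReal.toReal_nonneg)).trans ?_
  exact ENNReal.ofReal_toReal_le

/-- The tangent-line form of `u ^ 2 / q ≥ 2 t u v - t ^ 2 q v ^ 2`. -/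
theorem two_mul_sub_le_sq_div {q : ℝ} (hq : 0 < q) (t u v : ℝ) :
    2 * t * (u * v) - t ^ 2 * (q * v ^ 2) ≤ u ^ 2 / q := by
  rw [le_div_iff₀ hq]
  nlinarith [sq_nonneg (u - t * q * v)]

/-- **Hammersley–Chapman–Robbins bound** (Lemma 2 of the paper).
For probability measures `P, Q` with densities `p, q` strictly positive on the common
support `ω`, and a function of interest `f` with finite means `EP, EQ` and finite
variances `VP, VQ` with `VQ > 0`, the chi-square divergence satisfies
`χ²(P‖Q) ≥ (EQ - EP)² / VQ`.  (The chi-square divergence, possibly infinite, is expressed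
as a lower integral.) -/
theorem hammersley_chapman_robbins
    {α : Type*} [MeasurableSpace α] (lam : Measure α) [SigmaFinite lam]
    (ω : Set α) (hω : MeasurableSet ω)
    (p q f : α → ℝ)
    (hpm : Measurable p) (hqm : Measurable q) (hfm : Measurable f)
    (hppos : ∀ x ∈ ω, 0 < p x) (hqpos : ∀ x ∈ ω, 0 < q x)
    (hPnorm : ∫ x in ω, p x ∂lam = 1) (hQnorm : ∫ x in ω, q x ∂lam = 1)
    (hPf : IntegrableOn (fun x => p x * f x) ω lam)
    (hQf : IntegrableOn (fun x => q x * f x) ω lam)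
    (hPf2 : IntegrableOn (fun x => p x * f x ^ 2) ω lam)
    (hQf2 : IntegrableOn (fun x => q x * f x ^ 2) ω lam)
    (EP EQ VP VQ : ℝ)
    (hEP : EP = ∫ x in ω, p x * f x ∂lam)
    (hEQ : EQ = ∫ x in ω, q x * f x ∂lam)
    (hVP : VP = (∫ x in ω, p x * f x ^ 2 ∂lam) - EP ^ 2)
    (hVQ : VQ = (∫ x in ω, q x * f x ^ 2 ∂lam) - EQ ^ 2)
    (hVQpos : 0 < VQ) :
    ENNReal.ofReal ((EQ - EP) ^ 2 / VQ) ≤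
      ∫⁻ x in ω, ENNReal.ofReal ((q x - p x) ^ 2 / q x) ∂lam := by
  have hp : Integrable p (lam.restrict ω) := .of_integral_ne_zero (by simp [hPnorm])
  have hq : Integrable q (lam.restrict ω) := .of_integral_ne_zero (by simp [hQnorm])
  set t : ℝ := (EQ - EP) / VQ with ht
  have hA : Integrable (fun x => q x * f x - p x * f x) (lam.restrict ω) := hQf.sub hPf
  have hB : Integrable (fun x => q x - p x) (lam.restrict ω) := hq.sub hp
  have hC : Integrable (fun x => (q x * f x - p x * f x) - EQ * (q x - p x)) (lam.restrict ω) :=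
    hA.sub (hB.const_mul EQ)
  have hD : Integrable (fun x => q x * f x ^ 2 - 2 * EQ * (q x * f x)) (lam.restrict ω) :=
    hQf2.sub (hQf.const_mul _)
  have hE : Integrable (fun x => q x * f x ^ 2 - 2 * EQ * (q x * f x) + EQ ^ 2 * q x)
      (lam.restrict ω) := hD.add (hq.const_mul _)
  have hint : Integrable (fun x => 2 * t * ((q x * f x - p x * f x) - EQ * (q x - p x))
      - t ^ 2 * (q x * f x ^ 2 - 2 * EQ * (q x * f x) + EQ ^ 2 * q x)) (lam.restrict ω) :=
    (hC.const_mul _).sub (hE.const_mul _)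
  have hval : ∫ x in ω, (2 * t * ((q x * f x - p x * f x) - EQ * (q x - p x))
      - t ^ 2 * (q x * f x ^ 2 - 2 * EQ * (q x * f x) + EQ ^ 2 * q x)) ∂lam
      = (EQ - EP) ^ 2 / VQ := by
    rw [integral_sub (hC.const_mul _) (hE.const_mul _), integral_const_mul, integral_const_mul,
      integral_sub hA (hB.const_mul _), integral_const_mul, integral_sub hQf hPf,
      integral_sub hq hp, integral_add hD (hq.const_mul _), integral_sub hQf2 (hQf.const_mul _),
      integral_const_mul, integral_const_mul, hPnorm, hQnorm, ← hEP, ← hEQ,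
      show ∫ x in ω, q x * f x ^ 2 ∂lam = VQ + EQ ^ 2 by linarith, ht]
    field_simp
    ring
  rw [← hval]
  refine (ofReal_integral_le_lintegral_ofReal hint).trans (setLIntegral_mono' hω fun x hx => ?_)
  refine ENNReal.ofReal_le_ofReal (le_trans (le_of_eq ?_)
    (two_mul_sub_le_sq_div (hqpos x hx) t (q x - p x) (f x - EQ)))
  ring
end

section
/- Let λ be a σ-finite measure, P and Q probability measures with densities p, q strictly positive on a common support ω, and f: ω → ℝ measurable with finite means E_P, E_Q and finite variances V_P, V_Q, with V_Q > 0. Then equality χ²(P‖Q) = (E_Q − E_P)² / V_Q holds if and only if there exists a constant C ∈ ℝ such that (q(x) − p(x))/q(x) = C·(f(x) − E_Q) for λ-almost every x ∈ ω. -/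
open MeasureTheory

/-- Pointwise form of `MeasureTheory.Integrable.sub`. -/
theorem MeasureTheory.Integrable.fun_sub {α : Type*} [MeasurableSpace α] {μ : Measure α}
    {u v : α → ℝ} (hu : Integrable u μ) (hv : Integrable v μ) :
    Integrable (fun x => u x - v x) μ :=
  hu.sub hv

/-- **Equality condition of the Hammersley–Chapman–Robbins bound** (Lemma 2 of the paper).
Equality `χ²(P‖Q) = (EQ - EP)² / VQ` holds if and only if there exists a constant `C ∈ ℝ`
such that `(q x - p x)/q x = C (f x - EQ)` for λ-almost every `x ∈ ω`. -/
theorem hammersley_chapman_robbins_equality_iff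
    {α : Type*} [MeasurableSpace α] (lam : Measure α) [SigmaFinite lam]
    (ω : Set α) (hω : MeasurableSet ω)
    (p q f : α → ℝ)
    (hpm : Measurable p) (hqm : Measurable q) (hfm : Measurable f)
    (hppos : ∀ x ∈ ω, 0 < p x) (hqpos : ∀ x ∈ ω, 0 < q x)
    (hPnorm : ∫ x in ω, p x ∂lam = 1) (hQnorm : ∫ x in ω, q x ∂lam = 1)
    (hPf : IntegrableOn (fun x => p x * f x) ω lam)
    (hQf : IntegrableOn (fun x => q x * f x) ω lam)
    (hPf2 : IntegrableOn (fun x => p x * f x ^ 2) ω lam)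
    (hQf2 : IntegrableOn (fun x => q x * f x ^ 2) ω lam)
    (EP EQ VP VQ : ℝ)
    (hEP : EP = ∫ x in ω, p x * f x ∂lam)
    (hEQ : EQ = ∫ x in ω, q x * f x ∂lam)
    (hVP : VP = (∫ x in ω, p x * f x ^ 2 ∂lam) - EP ^ 2)
    (hVQ : VQ = (∫ x in ω, q x * f x ^ 2 ∂lam) - EQ ^ 2)
    (hVQpos : 0 < VQ) :
    (∫⁻ x in ω, ENNReal.ofReal ((q x - p x) ^ 2 / q x) ∂lam =
        ENNReal.ofReal ((EQ - EP) ^ 2 / VQ)) ↔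
      ∃ C : ℝ, ∀ᵐ x ∂(lam.restrict ω), (q x - p x) / q x = C * (f x - EQ) := by
  set μ := lam.restrict ω with hμ
  have hmem : ∀ᵐ x ∂μ, x ∈ ω := ae_restrict_mem hω
  have hp : Integrable p μ := .of_integral_ne_zero (by rw [hPnorm]; exact one_ne_zero)
  have hq : Integrable q μ := .of_integral_ne_zero (by rw [hQnorm]; exact one_ne_zero)
  replace hPf : Integrable (fun x => p x * f x) μ := hPf
  replace hQf : Integrable (fun x => q x * f x) μ := hQf
  replace hQf2 : Integrable (fun x => q x * f x ^ 2) μ := hQf2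
  have hcov_eq : (fun x => (q x - p x) * (f x - EQ)) =
      fun x => (q x * f x - p x * f x) - EQ * (q x - p x) := by
    funext x; ring
  have hcov : Integrable (fun x => (q x - p x) * (f x - EQ)) μ := by
    rw [hcov_eq]
    exact (hQf.sub hPf).sub ((hq.sub hp).const_mul EQ)
  have hcov_int : ∫ x, (q x - p x) * (f x - EQ) ∂μ = EQ - EP := by
    rw [hcov_eq, integral_sub (hQf.fun_sub hPf) ((hq.fun_sub hp).const_mul EQ),
      integral_sub hQf hPf, integral_const_mul, integral_sub hq hp, hPnorm, hQnorm,
      ← hEQ, ← hEP]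
    ring
  have hvar_eq : (fun x => q x * (f x - EQ) ^ 2) =
      fun x => (q x * f x ^ 2 - 2 * EQ * (q x * f x)) + EQ ^ 2 * q x := by
    funext x; ring
  have hvar : Integrable (fun x => q x * (f x - EQ) ^ 2) μ := by
    rw [hvar_eq]
    exact (hQf2.sub (hQf.const_mul _)).add (hq.const_mul _)
  have hvar_int : ∫ x, q x * (f x - EQ) ^ 2 ∂μ = VQ := by
    rw [hvar_eq, integral_add (hQf2.fun_sub (hQf.const_mul (2 * EQ))) (hq.const_mul (EQ ^ 2)),
      integral_sub hQf2 (hQf.const_mul (2 * EQ)), integral_const_mul, integral_const_mul, hQnorm,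
      ← hEQ, hVQ]
    ring
  have hchi_nonneg : 0 ≤ᵐ[μ] fun x => (q x - p x) ^ 2 / q x := by
    filter_upwards [hmem] with x hx
    exact div_nonneg (sq_nonneg _) (hqpos x hx).le
  have hbound : 0 ≤ (EQ - EP) ^ 2 / VQ := by positivity
  constructor
  · intro h
    have hchi : Integrable (fun x => (q x - p x) ^ 2 / q x) μ := by
      refine ⟨(((hqm.sub hpm).pow_const 2).div hqm).aestronglyMeasurable, ?_⟩
      rw [hasFiniteIntegral_iff_ofReal hchi_nonneg, h]
      exact ENNReal.ofReal_lt_top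
    have hchi_int : ∫ x, (q x - p x) ^ 2 / q x ∂μ = (EQ - EP) ^ 2 / VQ := by
      rw [integral_eq_lintegral_of_nonneg_ae hchi_nonneg hchi.1, h, ENNReal.toReal_ofReal hbound]
    refine ⟨(EQ - EP) / VQ, ?_⟩
    set C := (EQ - EP) / VQ with hC
    have hexp : (fun x => q x * ((q x - p x) / q x - C * (f x - EQ)) ^ 2) =ᵐ[μ]
        fun x => ((q x - p x) ^ 2 / q x - 2 * C * ((q x - p x) * (f x - EQ)))
          + C ^ 2 * (q x * (f x - EQ) ^ 2) := by
      filter_upwards [hmem] with x hx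
      have := (hqpos x hx).ne'
      field_simp
      ring
    have hres : Integrable (fun x => q x * ((q x - p x) / q x - C * (f x - EQ)) ^ 2) μ :=
      ((hchi.sub (hcov.const_mul _)).add (hvar.const_mul _)).congr hexp.symm
    have hres_int : ∫ x, q x * ((q x - p x) / q x - C * (f x - EQ)) ^ 2 ∂μ = 0 := by
      rw [integral_congr_ae hexp, integral_add (hchi.fun_sub (hcov.const_mul (2 * C)))
          (hvar.const_mul (C ^ 2)),
        integral_sub hchi (hcov.const_mul (2 * C)), integral_const_mul, integral_const_mul, hchi_int,
        hcov_int, hvar_int, hC]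
      field_simp
      ring
    have hres_nonneg : 0 ≤ᵐ[μ] fun x => q x * ((q x - p x) / q x - C * (f x - EQ)) ^ 2 := by
      filter_upwards [hmem] with x hx
      exact mul_nonneg (hqpos x hx).le (sq_nonneg _)
    filter_upwards [(integral_eq_zero_iff_of_nonneg_ae hres_nonneg hres).mp hres_int, hmem]
      with x hx0 hx
    have := (mul_eq_zero.mp hx0).resolve_left (hqpos x hx).ne'
    exact sub_eq_zero.mp (pow_eq_zero_iff two_ne_zero |>.mp this)
  · rintro ⟨C, hC⟩
    have hdiff : ∀ᵐ x ∂μ, q x - p x = C * (f x - EQ) * q x := by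
      filter_upwards [hC, hmem] with x hxC hx
      exact (div_eq_iff (hqpos x hx).ne').mp hxC
    have hCV : EQ - EP = C * VQ := by
      rw [← hcov_int, ← hvar_int, ← integral_const_mul]
      refine integral_congr_ae ?_
      filter_upwards [hdiff] with x hx
      rw [hx]
      ring
    have hchi_eq : (fun x => (q x - p x) ^ 2 / q x) =ᵐ[μ]
        fun x => C ^ 2 * (q x * (f x - EQ) ^ 2) := by
      filter_upwards [hdiff, hmem] with x hxd hx
      have := (hqpos x hx).ne'
      rw [hxd]
      field_simp
    rw [← ofReal_integral_eq_lintegral_ofReal ((hvar.const_mul _).congr hchi_eq.symm) hchi_nonneg,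
      integral_congr_ae hchi_eq, integral_const_mul, hvar_int, hCV]
    congr 1
    field_simp
end

section
/- Let p, q ∈ (0,1) with p ≠ q, and let P, Q be the Bernoulli distributions on {0,1} with P(1) = p and Q(1) = q. With the function of interest f(x) = x, so that E_P = p, E_Q = q, V_P = p(1−p), V_Q = q(1−q), set A = (q − p)² + V_P + V_Q and D = √(A² − 4·V_P·V_Q). Then the lower bound of Theorem 1 is attained with equality: KL(P‖Q) = p·log(p/q) + (1−p)·log((1−p)/(1−q)) = ((A − 2·V_P)/D)·artanh(D/A) + (1/2)·log(V_P/V_Q). -/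
/-- The inverse hyperbolic tangent of a normalized difference is half a log-ratio. -/
theorem artanh_sub_div_add {a b : ℝ} (ha : 0 < a) (hb : 0 < b) :
    artanh ((a - b) / (a + b)) = (1 / 2) * (Real.log a - Real.log b) := by
  have hab : a + b ≠ 0 := (add_pos ha hb).ne'
  have h1 : 1 + (a - b) / (a + b) = 2 * a / (a + b) := by field_simp; ring
  have h2 : 1 - (a - b) / (a + b) = 2 * b / (a + b) := by field_simp; ring
  rw [artanh, h1, h2, div_div_div_cancel_right₀ hab, mul_div_mul_left _ _ two_ne_zero,
    Real.log_div ha.ne' hb.ne']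

/-- **The Bernoulli distributions attain the lower bound with equality**
(Proposition 1 of the paper).  For Bernoulli distributions with success probabilities
`p ≠ q` and the function of interest `f(x) = x`, so that `EP = p`, `EQ = q`,
`VP = p(1-p)`, `VQ = q(1-q)`, `A = (q-p)² + VP + VQ`, `D = √(A² - 4 VP VQ)`, the
KL-divergence `p log(p/q) + (1-p) log((1-p)/(1-q))` equals the lower bound
`((A - 2 VP)/D) artanh (D/A) + (1/2) log (VP/VQ)` of Theorem 1. -/
theorem bernoulli_attains_kl_lower_bound
    (p q : ℝ) (hp : p ∈ Set.Ioo (0 : ℝ) 1) (hq : q ∈ Set.Ioo (0 : ℝ) 1) (hpq : p ≠ q)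
    (EP EQ VP VQ A D : ℝ)
    (hEP : EP = p) (hEQ : EQ = q)
    (hVP : VP = p * (1 - p)) (hVQ : VQ = q * (1 - q))
    (hA : A = (EQ - EP) ^ 2 + VP + VQ)
    (hD : D = Real.sqrt (A ^ 2 - 4 * VP * VQ)) :
    p * Real.log (p / q) + (1 - p) * Real.log ((1 - p) / (1 - q)) =
      (A - 2 * VP) / D * artanh (D / A) + (1 / 2) * Real.log (VP / VQ) := by
  subst hEP hEQ hVP hVQ
  obtain ⟨hp0, hp1⟩ := hp
  obtain ⟨hq0, hq1⟩ := hq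
  have hp1' : 0 < 1 - EP := sub_pos.mpr hp1
  have hq1' : 0 < 1 - EQ := sub_pos.mpr hq1
  have hD' : D = |EP - EQ| := by
    rw [hD, ← Real.sqrt_sq_eq_abs, hA]
    congr 1
    ring
  have hVP2 : A - 2 * (EP * (1 - EP)) = (EP - EQ) * (2 * EP - 1) := by rw [hA]; ring
  have hne : EP - EQ ≠ 0 := sub_ne_zero.mpr hpq
  have key : (A - 2 * (EP * (1 - EP))) / D * artanh (D / A) =
      (2 * EP - 1) * ((1 / 2) * (Real.log (EP * (1 - EQ)) - Real.log (EQ * (1 - EP)))) := by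
    have ha : 0 < EP * (1 - EQ) := mul_pos hp0 hq1'
    have hb : 0 < EQ * (1 - EP) := mul_pos hq0 hp1'
    rw [hVP2]
    rcases abs_choice (EP - EQ) with h | h
    · have hDA : D / A = (EP * (1 - EQ) - EQ * (1 - EP)) / (EP * (1 - EQ) + EQ * (1 - EP)) := by
        rw [hD', h, hA]
        congr 1 <;> ring
      rw [hDA, artanh_sub_div_add ha hb, hD', h, mul_div_cancel_left₀ _ hne]
    · have hDA : D / A = (EQ * (1 - EP) - EP * (1 - EQ)) / (EQ * (1 - EP) + EP * (1 - EQ)) := by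
        rw [hD', h, hA]
        congr 1 <;> ring
      rw [hDA, artanh_sub_div_add hb ha, hD', h, div_neg, mul_div_cancel_left₀ _ hne]
      ring
  rw [key, Real.log_div hp0.ne' hq0.ne', Real.log_div hp1'.ne' hq1'.ne',
    Real.log_div (mul_pos hp0 hp1').ne' (mul_pos hq0 hq1').ne',
    Real.log_mul hp0.ne' hq1'.ne', Real.log_mul hq0.ne' hp1'.ne',
    Real.log_mul hp0.ne' hp1'.ne', Real.log_mul hq0.ne' hq1'.ne']
  ring
end

section
/- Let ψ' ∈ ℝ and V_P > 0. Suppose a: ℝ → ℝ and W: ℝ → ℝ satisfy a(δ) = ψ'·δ + O(δ²) and W(δ) = V_P + O(δ) as δ → 0, with W(δ) > 0. Then, as δ → 0, ∫₀¹ [ t·a(δ)² / ( t(1−t)·a(δ)² + (1−t)·V_P + t·W(δ) ) ] dt = δ²·ψ'²/(2·V_P) + O(δ³). In particular, for a one-parameter family of densities p(x;θ) with ψ(θ) = E_{p(·;θ)}[f] differentiable, V_P = Var_{p(·;θ)}(f), a(δ) = E_{p(·;θ+δ)}[f] − E_{p(·;θ)}[f], W(δ) = Var_{p(·;θ+δ)}(f),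 and combined with KL(p(·;θ)‖p(·;θ+δ)) = (1/2)·I(θ)·δ² + O(δ³) where I(θ) = ∫ (∂_θ p(x;θ))²/p(x;θ) dλ(x) is the Fisher information, the lower bound of Theorem 1 yields the Cramér–Rao bound I(θ) ≥ ψ'(θ)²/Var_{p(·;θ)}(f) in the limit δ → 0. -/
open MeasureTheory Asymptotics Filter

/-- Freezing the denominator of the lower-bound integrand at `V` changes the integral by at most
`2 A (A + |w - V|) / V²`, as long as `w` stays above `V / 2`. -/
lemma abs_lowerBound_integral_sub_le {V A w : ℝ} (hV : 0 < V) (hA : 0 ≤ A) (hw : V / 2 ≤ w) :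
    |(∫ t in (0 : ℝ)..1, t * A / (t * (1 - t) * A + (1 - t) * V + t * w)) - A / (2 * V)| ≤
      2 / V ^ 2 * (A * (A + |w - V|)) := by
  have hD : ∀ t ∈ Set.Icc (0 : ℝ) 1, V / 2 ≤ t * (1 - t) * A + (1 - t) * V + t * w := by
    rintro t ⟨h0, h1⟩
    have h2 : 0 ≤ t * (1 - t) * A := mul_nonneg (mul_nonneg h0 (sub_nonneg.2 h1)) hA
    nlinarith [mul_le_mul_of_nonneg_left hw h0, mul_nonneg (sub_nonneg.2 h1) hV.le]
  have hint : IntervalIntegrable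
      (fun t : ℝ => t * A / (t * (1 - t) * A + (1 - t) * V + t * w)) volume 0 1 := by
    refine ContinuousOn.intervalIntegrable ?_
    rw [Set.uIcc_of_le zero_le_one]
    refine ContinuousOn.div (by fun_prop) (by fun_prop) fun t ht => ?_
    have := hD t ht
    linarith
  have hlin : (∫ t in (0 : ℝ)..1, t * A / V) = A / (2 * V) := by
    simp only [mul_div_assoc, intervalIntegral.integral_mul_const, integral_id]
    field_simp
    norm_num
  have hint' : IntervalIntegrable (fun t : ℝ => t * A / V) volume 0 1 :=
    (by fun_prop : Continuous fun t : ℝ => t * A / V).intervalIntegrable _ _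
  rw [← hlin, ← intervalIntegral.integral_sub hint hint', ← Real.norm_eq_abs]
  refine (intervalIntegral.norm_integral_le_of_norm_le_const
    (C := 2 / V ^ 2 * (A * (A + |w - V|))) fun t ht => ?_).trans (by simp)
  rw [Set.uIoc_of_le zero_le_one] at ht
  obtain ⟨h0, h1⟩ := ht
  have hDt := hD t ⟨h0.le, h1⟩
  set D := t * (1 - t) * A + (1 - t) * V + t * w with hDdef
  have hDpos : 0 < D := by linarith
  have hVD : |V - D| ≤ A + |w - V| := by
    have e : V - D = -(t * (1 - t) * A) - t * (w - V) := by rw [hDdef]; ring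
    have ht0 : 0 ≤ t * (1 - t) := mul_nonneg h0.le (sub_nonneg.2 h1)
    have ht1 : t * (1 - t) ≤ 1 := by nlinarith
    rw [e]
    refine (abs_sub _ _).trans (add_le_add ?_ ?_)
    · rw [abs_neg, abs_of_nonneg (mul_nonneg ht0 hA)]
      exact mul_le_of_le_one_left hA ht1
    · rw [abs_mul, abs_of_pos h0]
      exact mul_le_of_le_one_left (abs_nonneg _) h1
  have e : t * A / D - t * A / V = t * A * (V - D) / (D * V) := by
    field_simp
  rw [e, Real.norm_eq_abs, abs_div, abs_mul, abs_of_nonneg (mul_nonneg h0.le hA),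
    abs_of_pos (mul_pos hDpos hV)]
  calc t * A * |V - D| / (D * V)
      ≤ A * (A + |w - V|) / (V / 2 * V) := by
        gcongr
        exact mul_le_of_le_one_left hA h1
    _ = 2 / V ^ 2 * (A * (A + |w - V|)) := by
        field_simp

/-- Second-order expansion of the lower-bound integral at the base point. -/
lemma lowerBound_integral_isBigO {ψ' V : ℝ} (hV : 0 < V) {a W : ℝ → ℝ}
    (ha : (fun δ => a δ - ψ' * δ) =O[nhds (0 : ℝ)] fun δ => δ ^ 2)
    (hW : (fun δ => W δ - V) =O[nhds (0 : ℝ)] fun δ => δ) :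
    (fun δ => (∫ t in (0 : ℝ)..1,
        t * a δ ^ 2 / (t * (1 - t) * a δ ^ 2 + (1 - t) * V + t * W δ)) -
          δ ^ 2 * ψ' ^ 2 / (2 * V)) =O[nhds (0 : ℝ)] fun δ => δ ^ 3 := by
  have hid : Tendsto (fun δ : ℝ => δ) (nhds 0) (nhds 0) := tendsto_id
  have hpow : (fun δ : ℝ => δ ^ 2) =O[nhds (0 : ℝ)] fun δ => δ := by
    simpa [pow_two] using
      (hid.isBigO_one ℝ).mul (isBigO_refl (fun δ : ℝ => δ) (nhds 0))
  have hlin : (fun δ : ℝ => ψ' * δ) =O[nhds (0 : ℝ)] fun δ => δ :=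
    (isBigO_refl _ _).const_mul_left _
  have ha1 : a =O[nhds (0 : ℝ)] fun δ => δ := by
    simpa using (ha.trans hpow).add hlin
  have hsq : (fun δ => a δ ^ 2) =O[nhds (0 : ℝ)] fun δ => δ ^ 2 := ha1.pow 2
  have hmain : (fun δ => a δ ^ 2 / (2 * V) - δ ^ 2 * ψ' ^ 2 / (2 * V))
      =O[nhds (0 : ℝ)] fun δ => δ ^ 3 := by
    refine ((ha.mul (ha1.add hlin)).const_mul_left (1 / (2 * V))).congr (fun δ => ?_)
      (fun δ => ?_) <;> ring
  have herr : (fun δ => a δ ^ 2 * (a δ ^ 2 + |W δ - V|)) =O[nhds (0 : ℝ)] fun δ => δ ^ 3 :=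
    (hsq.mul ((hsq.trans hpow).add hW.abs_left)).congr_right fun δ => by ring
  have hWlim : ∀ᶠ δ in nhds (0 : ℝ), V / 2 ≤ W δ := by
    filter_upwards [(hW.trans_tendsto hid).eventually_const_le (by linarith : -(V / 2) < 0)]
      with δ hδ
    linarith
  have hdiff : (fun δ => (∫ t in (0 : ℝ)..1,
        t * a δ ^ 2 / (t * (1 - t) * a δ ^ 2 + (1 - t) * V + t * W δ)) - a δ ^ 2 / (2 * V))
      =O[nhds (0 : ℝ)] fun δ => δ ^ 3 := by
    refine (IsBigO.of_bound (2 / V ^ 2) ?_).trans herr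
    filter_upwards [hWlim] with δ hδ
    rw [Real.norm_eq_abs, Real.norm_of_nonneg (by positivity)]
    exact abs_lowerBound_integral_sub_le hV (sq_nonneg _) hδ
  simpa using hdiff.add hmain

/-- A quadratic that is bounded above by an `O(δ³)` function has nonpositive coefficient. -/
lemma nonpos_of_mul_sq_le_isBigO {c : ℝ} {F : ℝ → ℝ}
    (hF : F =O[nhds (0 : ℝ)] fun δ => δ ^ 3) (hle : ∀ δ, c * δ ^ 2 ≤ F δ) : c ≤ 0 := by
  by_contra! hc
  obtain ⟨C, hC⟩ := hF.bound
  have hsmall : ∀ᶠ δ in nhds (0 : ℝ), C * δ < c :=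
    ((continuous_const_mul C).tendsto' 0 0 (by simp)).eventually_lt_const hc
  obtain ⟨δ, ⟨h1, h2⟩, hδ⟩ :=
    (((hC.and hsmall).filter_mono nhdsWithin_le_nhds).and
      (self_mem_nhdsWithin (s := Set.Ioi (0 : ℝ)))).exists
  have hδ : 0 < δ := hδ
  rw [Real.norm_of_nonneg (pow_pos hδ 3).le] at h1
  have h3 := (hle δ).trans ((le_abs_self _).trans h1)
  nlinarith [mul_lt_mul_of_pos_right h2 (pow_pos hδ 2)]

/-- **The lower bound recovers the Cramér–Rao bound in the local limit**
(Proposition 2 of the paper).  Suppose `a δ = ψ' δ + O(δ²)` and `W δ = VP + O(δ)` as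
`δ → 0` with `W δ > 0` and `VP > 0` (the abstract versions of
`a δ = E_{θ+δ}[f] - E_θ[f]`, `W δ = Var_{θ+δ}(f)`, `VP = Var_θ(f)`, `ψ' = ψ'(θ)`).  Then
the lower-bound integral of Theorem 1 satisfies
`∫₀¹ t a δ² / (t(1-t) a δ² + (1-t) VP + t W δ) dt = δ² ψ'²/(2 VP) + O(δ³)`;
moreover, if `K δ` (playing the role of `KL(p(·;θ)‖p(·;θ+δ))`) dominates this integral and
`K δ = (1/2) I δ² + O(δ³)` (with `I` the Fisher information at `θ`), then the Cramér–Rao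
bound `I ≥ ψ'²/VP` holds. -/
theorem lower_bound_gives_cramer_rao
    (ψ' VP : ℝ) (hVP : 0 < VP)
    (a W : ℝ → ℝ)
    (ha : (fun δ => a δ - ψ' * δ) =O[nhds (0 : ℝ)] fun δ => δ ^ 2)
    (hW : (fun δ => W δ - VP) =O[nhds (0 : ℝ)] fun δ => δ)
    (hWpos : ∀ δ, 0 < W δ)
    (K : ℝ → ℝ) (I : ℝ)
    (hK : ∀ δ, (∫ t in (0 : ℝ)..1,
        t * a δ ^ 2 / (t * (1 - t) * a δ ^ 2 + (1 - t) * VP + t * W δ)) ≤ K δ)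
    (hKasym : (fun δ => K δ - 1 / 2 * I * δ ^ 2) =O[nhds (0 : ℝ)] fun δ => δ ^ 3) :
    ((fun δ => (∫ t in (0 : ℝ)..1,
        t * a δ ^ 2 / (t * (1 - t) * a δ ^ 2 + (1 - t) * VP + t * W δ)) -
          δ ^ 2 * ψ' ^ 2 / (2 * VP)) =O[nhds (0 : ℝ)] fun δ => δ ^ 3) ∧
      ψ' ^ 2 / VP ≤ I := by
  have hL := lowerBound_integral_isBigO hVP ha hW
  refine ⟨hL, ?_⟩
  have hc : ψ' ^ 2 / (2 * VP) - 1 / 2 * I ≤ 0 := by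
    refine nonpos_of_mul_sq_le_isBigO (hKasym.sub hL) fun δ => ?_
    have e : (ψ' ^ 2 / (2 * VP) - 1 / 2 * I) * δ ^ 2 =
        δ ^ 2 * ψ' ^ 2 / (2 * VP) - 1 / 2 * I * δ ^ 2 := by ring
    rw [e]
    linarith [hK δ]
  have e : ψ' ^ 2 / (2 * VP) = 1 / 2 * (ψ' ^ 2 / VP) := by ring
  linarith
end

section
/- Let a ≥ 0 and V_P, V_Q > 0, and set A = a + V_P + V_Q and D = √(A² − 4·V_P·V_Q); assume D > 0. Then ∫₀¹ [ t·a / ( t(1−t)·a + (1−t)·V_P + t·V_Q ) ] dt = ((A − 2·V_P)/D)·artanh(D/A) + (1/2)·log(V_P/V_Q). -/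
/-- **The closed form of the lower-bound integral** (equations (16)–(19) of the paper).
For `a ≥ 0`, `VP, VQ > 0`, `A = a + VP + VQ`, `D = √(A² - 4 VP VQ) > 0`,
`∫₀¹ t a / (t(1-t) a + (1-t) VP + t VQ) dt = ((A - 2 VP)/D) artanh (D/A) + (1/2) log (VP/VQ)`. -/
theorem integral_lower_bound_closed_form
    (a VP VQ : ℝ) (ha : 0 ≤ a) (hVP : 0 < VP) (hVQ : 0 < VQ)
    (A D : ℝ) (hA : A = a + VP + VQ) (hD : D = Real.sqrt (A ^ 2 - 4 * VP * VQ))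
    (hDpos : 0 < D) :
    (∫ t in (0 : ℝ)..1, t * a / (t * (1 - t) * a + (1 - t) * VP + t * VQ)) =
      (A - 2 * VP) / D * artanh (D / A) + (1 / 2) * Real.log (VP / VQ) := by
  have hApos : 0 < A := by linarith
  have hsq : D ^ 2 = A ^ 2 - 4 * VP * VQ := by
    rw [hD]
    exact Real.sq_sqrt (Real.sqrt_pos.mp (hD ▸ hDpos)).le
  have hDA : D < A := by nlinarith [mul_pos hVP hVQ]
  set q : ℝ → ℝ := fun t => t * (1 - t) * a + (1 - t) * VP + t * VQ with hq
  set u : ℝ → ℝ := fun t => 2 * VP * (1 - t) + (A + D) * t with hu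
  set v : ℝ → ℝ := fun t => 2 * VP * (1 - t) + (A - D) * t with hv
  have convex_pos (x y t : ℝ) (hx : 0 < x) (hy : 0 < y) (ht : t ∈ Set.Icc (0 : ℝ) 1) :
      0 < x * (1 - t) + y * t := by
    rcases ht.1.eq_or_lt with rfl | h0
    · simpa using hx
    · have := mul_nonneg hx.le (sub_nonneg.mpr ht.2)
      have := mul_pos hy h0
      linarith
  have hupos (t : ℝ) (ht : t ∈ Set.Icc (0 : ℝ) 1) : 0 < u t :=
    convex_pos _ _ t (by linarith) (by linarith) ht
  have hvpos (t : ℝ) (ht : t ∈ Set.Icc (0 : ℝ) 1) : 0 < v t :=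
    convex_pos _ _ t (by linarith) (by linarith) ht
  have hqpos (t : ℝ) (ht : t ∈ Set.Icc (0 : ℝ) 1) : 0 < q t := by
    have h1 := convex_pos VP VQ t hVP hVQ ht
    have h2 := mul_nonneg (mul_nonneg ht.1 (sub_nonneg.mpr ht.2)) ha
    simp only [hq]
    linarith
  have huv (t : ℝ) : u t * v t = 4 * VP * q t := by
    simp only [hq, hu, hv]
    subst hA
    linear_combination (-t ^ 2) * hsq
  have hderiv (t : ℝ) (ht : t ∈ Set.uIcc (0 : ℝ) 1) :
      HasDerivAt (fun t => (A - 2 * VP) / (2 * D) * (Real.log (u t) - Real.log (v t))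
        - 1 / 2 * Real.log (q t)) (t * a / q t) t := by
    rw [Set.uIcc_of_le zero_le_one] at ht
    have h1 : HasDerivAt (fun t : ℝ => 1 - t) (-1) t := by
      simpa using (hasDerivAt_id t).const_sub 1
    have h_u : HasDerivAt u (A + D - 2 * VP) t := by
      refine HasDerivAt.congr_deriv ((h1.const_mul (2 * VP)).add ((hasDerivAt_id t).const_mul (A + D))) ?_
      ring
    have h_v : HasDerivAt v (A - D - 2 * VP) t := by
      refine HasDerivAt.congr_deriv ((h1.const_mul (2 * VP)).add ((hasDerivAt_id t).const_mul (A - D))) ?_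
      ring
    have h_q : HasDerivAt q ((A - 2 * VP) - 2 * a * t) t := by
      refine HasDerivAt.congr_deriv (((((hasDerivAt_id t).mul h1).mul_const a).add (h1.mul_const VP)).add
        ((hasDerivAt_id t).mul_const VQ)) ?_
      simp only [id]
      rw [hA]
      ring
    have hu0 := (hupos t ht).ne'
    have hv0 := (hvpos t ht).ne'
    have hq0 := (hqpos t ht).ne'
    have key : (A + D - 2 * VP) / u t - (A - D - 2 * VP) / v t = D / q t := by
      rw [div_sub_div _ _ hu0 hv0, huv, div_eq_div_iff (by positivity) hq0]
      simp only [hu, hv]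
      ring
    refine HasDerivAt.congr_deriv ((((h_u.log hu0).sub (h_v.log hv0)).const_mul ((A - 2 * VP) / (2 * D))).sub
      ((h_q.log hq0).const_mul (1 / 2))) ?_
    rw [key]
    field_simp
    ring
  have hint : IntervalIntegrable (fun t => t * a / q t) MeasureTheory.volume 0 1 := by
    apply ContinuousOn.intervalIntegrable
    rw [Set.uIcc_of_le zero_le_one]
    exact ContinuousOn.div (by fun_prop) (by fun_prop) fun t ht => (hqpos t ht).ne'
  rw [intervalIntegral.integral_eq_sub_of_hasDerivAt hderiv hint]
  have hratio : (1 + D / A) / (1 - D / A) = (A + D) / (A - D) := by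
    have : A - D ≠ 0 := by linarith
    field_simp
  rw [artanh, hratio, Real.log_div (by linarith) (by linarith),
    Real.log_div hVP.ne' hVQ.ne']
  simp only [hq, hu, hv]
  norm_num
  field_simp
  ring
end
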